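/- Assume the Riemann Hypothesis. Let N ≥ 2 be an integer, α ∈ [−1/2, 1/2] real, and z = 1/N − 2πiα. Then |S̃(α) − 1/z| ≪ N^{1/2}(1 + (N|α|)^{1/2}) log N, with an absolute implied constant. -/

import Mathlib

open Finset

/-- The von Mangoldt function. -/
noncomputable def vM (n : ℕ) : ℝ := ArithmeticFunction.vonMangoldt n

/-- `z = 1/N - 2πiα`. -/
noncomputable def zOf (N : ℕ) (α : ℝ) : ℂ :=
  1 / (N : ℂ) - 2 * (Real.pi : ℂ) * Complex.I * (α : ℂ)

/-- The weighted exponential sum `S̃(α) = ∑_{n ≥ 1} Λ(n) e^{-n/N} e(nα)`. -/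
noncomputable def Stilde (N : ℕ) (α : ℝ) : ℂ :=
  ∑' n : ℕ, (vM n : ℂ) * Real.exp (-(n : ℝ) / N) *
    Complex.exp (2 * (Real.pi : ℂ) * Complex.I * (n : ℂ) * (α : ℂ))

namespace StildeAux

open Complex Filter Topology Set

/-- The entire function `(s - 1) ζ(s)`. -/
noncomputable def zetaReg : ℂ → ℂ := Function.update (fun s ↦ (s - 1) * riemannZeta s) 1 1

lemma zetaReg_of_ne {s : ℂ} (hs : s ≠ 1) : zetaReg s = (s - 1) * riemannZeta s := by
  simp [zetaReg, Function.update_of_ne hs]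

lemma zetaReg_one : zetaReg 1 = 1 := by simp [zetaReg]

lemma differentiable_zetaReg : Differentiable ℂ zetaReg := by
  have hne : ∀ s : ℂ, s ≠ 1 → DifferentiableAt ℂ zetaReg s := fun s hs ↦ by
    have h : zetaReg =ᶠ[𝓝 s] fun s ↦ (s - 1) * riemannZeta s := by
      filter_upwards [isOpen_ne.mem_nhds hs] with u hu using zetaReg_of_ne hu
    exact ((differentiableAt_id.sub_const 1).mul (differentiableAt_riemannZeta hs))
      |>.congr_of_eventuallyEq h
  intro s
  rcases eq_or_ne s 1 with rfl | hs
  · refine AnalyticAt.differentiableAt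
      (Complex.analyticAt_of_differentiable_on_punctured_nhds_of_continuousAt ?_ ?_)
    · filter_upwards [self_mem_nhdsWithin] with u hu using hne u hu
    · rw [continuousAt_iff_punctured_nhds, zetaReg_one]
      refine riemannZeta_residue_one.congr' ?_
      filter_upwards [self_mem_nhdsWithin] with u hu using (zetaReg_of_ne hu).symm
  · exact hne s hs

lemma zetaReg_conj (s : ℂ) : zetaReg (starRingEnd ℂ s) = starRingEnd ℂ (zetaReg s) := by
  rcases eq_or_ne s 1 with rfl | hs
  · simp [zetaReg_one]
  · have : starRingEnd ℂ s ≠ 1 := fun h ↦ hs (by simpa using congrArg (starRingEnd ℂ) h)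
    rw [zetaReg_of_ne hs, zetaReg_of_ne this, riemannZeta_conj]
    simp

lemma zetaReg_re_eq_half (hRH : RiemannHypothesis) {s : ℂ} (hs : 0 < s.re) (h0 : zetaReg s = 0) :
    s.re = 1 / 2 := by
  have h1 : s ≠ 1 := by rintro rfl; simp [zetaReg_one] at h0
  rw [zetaReg_of_ne h1] at h0
  have h2 : riemannZeta s = 0 := (mul_eq_zero.mp h0).resolve_left (sub_ne_zero.mpr h1)
  refine hRH s h2 ?_ h1
  rintro ⟨n, rfl⟩
  simp at hs
  have : (0 : ℝ) ≤ n := n.cast_nonneg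
  linarith

/-- The terms of the series `(s - 1) ζ(s) = 1 + ∑ ((s - 1) n^{-s} - n^{1-s} + (n + 1)^{1-s})`. -/
noncomputable def zetaRegTerm (n : ℕ) (s : ℂ) : ℂ :=
  (s - 1) * ((n + 1 : ℕ) : ℂ) ^ (-s) - ((n + 1 : ℕ) : ℂ) ^ (1 - s) + ((n + 2 : ℕ) : ℂ) ^ (1 - s)

lemma differentiable_zetaRegTerm (n : ℕ) : Differentiable ℂ (zetaRegTerm n) := by
  intro s
  have h1 : ((n + 1 : ℕ) : ℂ) ≠ 0 := by exact_mod_cast n.succ_ne_zero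
  have h2 : ((n + 2 : ℕ) : ℂ) ≠ 0 := by exact_mod_cast (n + 1).succ_ne_zero
  unfold zetaRegTerm
  refine ((((differentiableAt_id.sub_const 1).mul ?_).sub ?_).add ?_)
  · exact (differentiableAt_id.neg).const_cpow (Or.inl h1)
  · exact (differentiableAt_id.const_sub 1).const_cpow (Or.inl h1)
  · exact (differentiableAt_id.const_sub 1).const_cpow (Or.inl h2)

lemma hasDerivAt_ofReal_cpow_pos {x : ℝ} (hx : 0 < x) (s : ℂ) :
    HasDerivAt (fun y : ℝ ↦ (y : ℂ) ^ s) (s * (x : ℂ) ^ (s - 1)) x := by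
  have h := (hasDerivAt_id (x : ℂ)).cpow_const (c := s) (Or.inl (by simpa using hx))
  simpa using h.comp_ofReal

lemma norm_zetaRegTerm_le (n : ℕ) {s : ℂ} (hs : 0 < s.re) :
    ‖zetaRegTerm n s‖ ≤ ‖s‖ * ‖s - 1‖ * ((n + 1 : ℕ) : ℝ) ^ (-s.re - 1) := by
  set a : ℝ := ((n + 1 : ℕ) : ℝ) with ha
  have ha0 : 0 < a := by rw [ha]; positivity
  set M : ℝ := ‖s‖ * ‖s - 1‖ * a ^ (-s.re - 1) with hM
  have hM0 : 0 ≤ M := by positivity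
  have hpos : ∀ x ∈ Set.Icc a (a + 1), 0 < x := fun x hx ↦ ha0.trans_le hx.1
  have hd1 : ∀ x ∈ Set.Icc a (a + 1),
      ‖(1 - s) * (x : ℂ) ^ (-s) - (1 - s) * (a : ℂ) ^ (-s)‖ ≤ M := by
    intro x hx
    have := (convex_Icc a (a + 1)).norm_image_sub_le_of_norm_hasDerivWithin_le (C := M)
      (f := fun y : ℝ ↦ (1 - s) * (y : ℂ) ^ (-s))
      (f' := fun y : ℝ ↦ (1 - s) * (-s * (y : ℂ) ^ (-s - 1)))
      (fun y hy ↦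
        ((hasDerivAt_ofReal_cpow_pos (hpos y hy) (-s)).const_mul (1 - s)).hasDerivWithinAt)
      (fun y hy ↦ ?_) (left_mem_Icc.mpr (by linarith)) hx
    · refine this.trans ?_
      rw [Real.norm_eq_abs, abs_of_nonneg (by linarith [hx.1])]
      nlinarith [hx.2]
    · rw [norm_mul, norm_mul, norm_neg, Complex.norm_cpow_eq_rpow_re_of_pos (hpos y hy), hM,
        norm_sub_rev 1 s, ← mul_assoc, mul_comm ‖s - 1‖]
      simp only [sub_re, neg_re, one_re]
      gcongr ?_ * ?_
      exact Real.rpow_le_rpow_of_nonpos ha0 hy.1 (by linarith)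
  have h2 := (convex_Icc a (a + 1)).norm_image_sub_le_of_norm_hasDerivWithin_le (C := M)
      (f := fun y : ℝ ↦ (y : ℂ) ^ (1 - s) - y * ((1 - s) * (a : ℂ) ^ (-s)))
      (f' := fun y : ℝ ↦ (1 - s) * (y : ℂ) ^ (-s) - 1 * ((1 - s) * (a : ℂ) ^ (-s)))
      (fun y hy ↦ ?_) (fun y hy ↦ by simpa using hd1 y hy)
      (left_mem_Icc.mpr (by linarith)) (right_mem_Icc.mpr (by linarith))
  · simp only [add_sub_cancel_left, norm_one, mul_one] at h2
    refine le_of_eq_of_le ?_ h2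
    have h3 : ((n + 2 : ℕ) : ℂ) = ((a + 1 : ℝ) : ℂ) := by rw [ha]; push_cast; ring
    have h4 : ((n + 1 : ℕ) : ℂ) = (a : ℂ) := by rw [ha]; push_cast; ring
    rw [zetaRegTerm, h3, h4]
    congr 1
    push_cast
    ring
  · have h5 := hasDerivAt_ofReal_cpow_pos (hpos y hy) (1 - s)
    rw [show (1 - s - 1 : ℂ) = -s by ring] at h5
    exact (h5.sub ((Complex.ofRealCLM.hasDerivAt (x := y)).mul_const _)).hasDerivWithinAt

lemma summable_nat_rpow_shift {σ : ℝ} (hσ : 0 < σ) :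
    Summable fun n : ℕ ↦ ((n + 1 : ℕ) : ℝ) ^ (-σ - 1) :=
  (summable_nat_add_iff 1).mpr (Real.summable_nat_rpow.mpr (by linarith))

lemma summable_zetaRegTerm {s : ℂ} (hs : 0 < s.re) : Summable fun n ↦ zetaRegTerm n s :=
  .of_norm_bounded ((summable_nat_rpow_shift hs).mul_left _) fun n ↦ norm_zetaRegTerm_le n hs

lemma zetaReg_eq_of_one_lt {s : ℂ} (hs : 1 < s.re) :
    zetaReg s = 1 + ∑' n, zetaRegTerm n s := by
  have hs1 : s ≠ 1 := by rintro rfl; simp at hs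
  have hsum : Summable fun n : ℕ ↦ 1 / ((n : ℂ) + 1) ^ s := by
    have := (summable_nat_add_iff 1).mpr (Complex.summable_one_div_nat_cpow.mpr hs)
    simpa using this
  have h1 : Tendsto (fun n ↦ ∑ k ∈ range n, zetaRegTerm k s) atTop
      (𝓝 ((s - 1) * riemannZeta s - 1)) := by
    have hpart : ∀ n : ℕ, ∑ k ∈ range n, zetaRegTerm k s =
        (s - 1) * (∑ k ∈ range n, 1 / ((k : ℂ) + 1) ^ s) - 1 + ((n + 1 : ℕ) : ℂ) ^ (1 - s) := by
      intro n
      induction n with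
      | zero => simp
      | succ n ih =>
        rw [sum_range_succ, ih, sum_range_succ, zetaRegTerm, cpow_neg]
        push_cast
        rw [add_assoc (n : ℂ) 1 1, one_add_one_eq_two]
        ring
    simp_rw [hpart]
    have h2 := (hsum.hasSum.tendsto_sum_nat.const_mul (s - 1)).sub_const 1
    rw [← zeta_eq_tsum_one_div_nat_add_one_cpow hs] at h2
    have h3 : Tendsto (fun n : ℕ ↦ ((n + 1 : ℕ) : ℂ) ^ (1 - s)) atTop (𝓝 0) := by
      rw [tendsto_zero_iff_norm_tendsto_zero]
      have : ∀ n : ℕ, ‖((n + 1 : ℕ) : ℂ) ^ (1 - s)‖ = ((n + 1 : ℕ) : ℝ) ^ (-(s.re - 1)) := by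
        intro n
        rw [norm_natCast_cpow_of_pos n.succ_pos]
        simp
      simp_rw [this]
      exact (tendsto_rpow_neg_atTop (by linarith)).comp
        (tendsto_natCast_atTop_atTop.comp (tendsto_add_atTop_nat 1))
    simpa using h2.add h3
  rw [zetaReg_of_ne hs1, tendsto_nhds_unique
    (summable_zetaRegTerm (by linarith)).hasSum.tendsto_sum_nat h1]
  ring

lemma zetaReg_eq {s : ℂ} (hs : 0 < s.re) : zetaReg s = 1 + ∑' n, zetaRegTerm n s := by
  have hopen : IsOpen {s : ℂ | 0 < s.re} := isOpen_lt continuous_const continuous_re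
  have hd : DifferentiableOn ℂ (fun s ↦ 1 + ∑' n, zetaRegTerm n s) {s : ℂ | 0 < s.re} := by
    intro u (hu : 0 < u.re)
    have hV : IsOpen ({s : ℂ | u.re / 2 < s.re} ∩ Metric.ball 0 (‖u‖ + 1)) :=
      (isOpen_lt continuous_const continuous_re).inter Metric.isOpen_ball
    have huV : u ∈ {s : ℂ | u.re / 2 < s.re} ∩ Metric.ball 0 (‖u‖ + 1) :=
      ⟨by simp only [Set.mem_ofPred_eq]; linarith, by simp⟩
    refine DifferentiableAt.differentiableWithinAt ?_
    refine DifferentiableAt.const_add _ ?_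
    refine (differentiableOn_tsum_of_summable_norm
      (u := fun n ↦ (‖u‖ + 1) * (‖u‖ + 2) * ((n + 1 : ℕ) : ℝ) ^ (-(u.re / 2) - 1))
      ((summable_nat_rpow_shift (by linarith)).mul_left _)
      (fun n ↦ (differentiable_zetaRegTerm n).differentiableOn) hV ?_).differentiableAt
      (hV.mem_nhds huV)
    rintro n w ⟨hw1, hw2⟩
    simp only [Set.mem_ofPred_eq] at hw1
    rw [mem_ball_zero_iff] at hw2
    refine (norm_zetaRegTerm_le n (by linarith)).trans ?_
    have : ‖w - 1‖ ≤ ‖u‖ + 2 := (norm_sub_le _ _).trans (by simp; linarith)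
    gcongr
    simp
  have hpre : IsPreconnected {s : ℂ | 0 < s.re} := (convex_halfSpace_re_gt 0).isPreconnected
  refine AnalyticOnNhd.eqOn_of_preconnected_of_eventuallyEq
    (differentiable_zetaReg.differentiableOn.analyticOnNhd hopen) (hd.analyticOnNhd hopen)
    hpre (z₀ := 2) (by simp) ?_ hs
  filter_upwards [(isOpen_lt continuous_const continuous_re).mem_nhds
    (show (1 : ℝ) < (2 : ℂ).re by simp)] with w hw using zetaReg_eq_of_one_lt hw

lemma exists_norm_zetaReg_le {σ : ℝ} (hσ : 0 < σ) :
    ∃ C : ℝ, 1 ≤ C ∧ ∀ s : ℂ, σ ≤ s.re → ‖zetaReg s‖ ≤ C * (1 + ‖s‖) ^ 2 := by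
  set B := ∑' n : ℕ, ((n + 1 : ℕ) : ℝ) ^ (-σ - 1) with hB
  have hB0 : 0 ≤ B := tsum_nonneg fun n ↦ by positivity
  refine ⟨1 + B, by linarith, fun s hs ↦ ?_⟩
  rw [zetaReg_eq (by linarith)]
  have h1 : ‖∑' n, zetaRegTerm n s‖ ≤ ‖s‖ * ‖s - 1‖ * B := by
    rw [hB, ← tsum_mul_left]
    refine tsum_of_norm_bounded ((summable_nat_rpow_shift hσ).mul_left _).hasSum fun n ↦ ?_
    refine (norm_zetaRegTerm_le n (by linarith)).trans ?_
    gcongr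
    simp
  have h2 : ‖s - 1‖ ≤ ‖s‖ + 1 := (norm_sub_le _ _).trans (by simp)
  have h3 : ‖s‖ * ‖s - 1‖ * B ≤ (1 + ‖s‖) ^ 2 * B := by
    gcongr
    nlinarith [norm_nonneg s]
  have h4 : (1 : ℝ) ≤ (1 + ‖s‖) ^ 2 := by nlinarith [norm_nonneg s]
  calc ‖1 + ∑' n, zetaRegTerm n s‖ ≤ 1 + ‖s‖ * ‖s - 1‖ * B := by
        refine (norm_add_le _ _).trans ?_
        simpa using h1
    _ ≤ _ := by nlinarith

lemma exists_le_norm_zetaReg_two_add :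
    ∃ C : ℝ, 0 < C ∧ ∀ t : ℝ, C ≤ ‖zetaReg (2 + t * I)‖ := by
  refine ⟨2 - Real.pi ^ 2 / 6, by nlinarith [Real.pi_lt_d2, Real.pi_pos], fun t ↦ ?_⟩
  set s : ℂ := 2 + t * I with hs
  have hre : s.re = 2 := by simp [hs]
  have hs1 : s ≠ 1 := fun h ↦ by rw [h] at hre; norm_num at hre
  have hsum2 : HasSum (fun n : ℕ ↦ 1 / ((n + 1 : ℕ) : ℝ) ^ 2) (Real.pi ^ 2 / 6) := by
    simpa using (hasSum_nat_add_iff' 1).mpr hasSum_zeta_two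
  have hsum1 : HasSum (fun n : ℕ ↦ 1 / ((n + 1 + 1 : ℕ) : ℝ) ^ 2) (Real.pi ^ 2 / 6 - 1) := by
    simpa using (hasSum_nat_add_iff' 1).mpr hsum2
  have hz : ‖riemannZeta s - 1‖ ≤ Real.pi ^ 2 / 6 - 1 := by
    have hsm : Summable fun n : ℕ ↦ 1 / ((n : ℂ) + 1) ^ s := by
      have := (summable_nat_add_iff 1).mpr
        (Complex.summable_one_div_nat_cpow.mpr (show 1 < s.re by rw [hre]; norm_num))
      simpa using this
    rw [zeta_eq_tsum_one_div_nat_add_one_cpow (by rw [hre]; norm_num), hsm.tsum_eq_zero_add]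
    simp only [Nat.cast_zero, zero_add, one_cpow, div_one, add_sub_cancel_left]
    refine tsum_of_norm_bounded hsum1 fun n ↦ ?_
    have h : (((n + 1 : ℕ) : ℂ) + 1) = ((n + 1 + 1 : ℕ) : ℂ) := by push_cast; ring
    rw [h, norm_div, norm_one, norm_natCast_cpow_of_pos (by lia), hre]
    norm_num
  have h1 : 2 - Real.pi ^ 2 / 6 ≤ ‖riemannZeta s‖ := by
    have := norm_sub_norm_le (1 : ℂ) (1 - riemannZeta s)
    rw [norm_sub_rev 1 (riemannZeta s)] at this
    simp only [norm_one, sub_sub_cancel] at this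
    linarith
  have h2 : 1 ≤ ‖s - 1‖ := by
    refine le_trans ?_ (abs_re_le_norm _)
    simp [hre]; norm_num
  rw [zetaReg_of_ne hs1, norm_mul]
  nlinarith [norm_nonneg (riemannZeta s)]

/-- Borel–Carathéodory for the logarithmic derivative of a zero-free function. -/
lemma norm_logDeriv_le_of_norm_le_exp {g : ℂ → ℂ} {A r r' : ℝ} (hr' : 0 < r') (hr : r' < r)
    (hA : 0 < A) (hg : Differentiable ℂ g) (hg0 : ∀ z ∈ Metric.ball (0 : ℂ) r, g z ≠ 0)
    (hb : ∀ z ∈ Metric.ball (0 : ℂ) r, ‖g z‖ ≤ Real.exp A * ‖g 0‖) {z : ℂ} (hz : ‖z‖ ≤ r') :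
    ‖logDeriv g z‖ ≤ 8 * r / (r - r') ^ 2 * A := by
  have h0r : (0 : ℂ) ∈ Metric.ball (0 : ℂ) r := Metric.mem_ball_self (by linarith)
  have hd : DifferentiableOn ℂ (logDeriv g) (Metric.ball 0 r) :=
    (hg.deriv.differentiableOn).div hg.differentiableOn hg0
  obtain ⟨h, hh0, hh⟩ := hd.isExactOn_ball.with_val_at 0 0
  have hexp : ∀ z ∈ Metric.ball (0 : ℂ) r, g z = g 0 * exp (h z) := by
    intro z hz
    have hconst := (convex_ball (0 : ℂ) r).norm_image_sub_le_of_norm_hasDerivWithin_le (C := 0)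
      (f := fun w ↦ g w * exp (-h w))
      (f' := fun w ↦ deriv g w * exp (-h w) + g w * (exp (-h w) * -(logDeriv g w)))
      (fun w hw ↦ ((hg w).hasDerivAt.mul (hh w hw).neg.cexp).hasDerivWithinAt)
      (fun w hw ↦ by
        rw [logDeriv_apply]
        have := hg0 w hw
        refine le_of_eq ?_
        rw [norm_eq_zero]
        field_simp
        ring) h0r hz
    simp only [zero_mul, hh0, neg_zero, exp_zero, mul_one] at hconst
    have h1 := sub_eq_zero.mp (norm_eq_zero.mp (le_antisymm hconst (norm_nonneg _)))
    rw [← h1, mul_assoc, ← exp_add]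
    simp
  have hre : MapsTo h (Metric.ball 0 r) {z | z.re ≤ A} := by
    intro w hw
    have h1 := hb w hw
    rw [hexp w hw, norm_mul, norm_exp, mul_comm] at h1
    have h2 := le_of_mul_le_mul_right h1 (norm_pos_iff.mpr (hg0 0 h0r))
    exact Real.exp_le_exp.mp h2
  have hhd : DifferentiableOn ℂ h (Metric.ball 0 r) := fun w hw ↦
    (hh w hw).differentiableAt.differentiableWithinAt
  set ρ := (r - r') / 2 with hρ
  have hρ0 : 0 < ρ := by rw [hρ]; linarith
  have hsub : Metric.closedBall z ρ ⊆ Metric.ball (0 : ℂ) r := by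
    intro w hw
    rw [mem_ball_zero_iff]
    rw [mem_closedBall_iff_norm] at hw
    have := norm_add_le (w - z) z
    rw [sub_add_cancel] at this
    linarith
  have hzr : z ∈ Metric.ball (0 : ℂ) r := hsub (Metric.mem_closedBall_self hρ0.le)
  have hbound : ∀ w ∈ Metric.sphere z ρ, ‖h w‖ ≤ 2 * A * r / ρ := by
    intro w hw
    have hw' := hsub (Metric.sphere_subset_closedBall hw)
    refine (borelCaratheodory_zero hA hhd hre (by linarith) hw' hh0).trans ?_
    have h3 : ‖w‖ ≤ r - ρ := by
      rw [mem_sphere_iff_norm] at hw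
      have := norm_add_le (w - z) z
      rw [sub_add_cancel] at this
      linarith
    have h4 : ‖w‖ ≤ r := by linarith
    have hr0 : 0 < r := hr'.trans hr
    gcongr
    linarith
  have := norm_deriv_le_of_forall_mem_sphere_norm_le hρ0
    ((hhd.mono hsub).diffContOnCl_ball subset_rfl) hbound
  rw [(hh z hzr).deriv] at this
  refine this.trans (le_of_eq ?_)
  rw [hρ]
  have : r - r' ≠ 0 := by linarith
  field_simp
  ring

section Zeros
variable {f g : ℂ → ℂ} {L r R : ℝ} {M : Multiset ℂ}

lemma norm_le_of_sphere (hR : 0 < R) (hg : Differentiable ℂ g) {B : ℝ}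
    (hB : ∀ z, ‖z‖ = R → ‖g z‖ ≤ B) {z : ℂ} (hz : ‖z‖ ≤ R) : ‖g z‖ ≤ B := by
  refine norm_le_of_forall_mem_frontier_norm_le (U := Metric.ball 0 R) Metric.isBounded_ball
    hg.diffContOnCl (fun w hw ↦ hB w ?_) ?_
  · rw [frontier_ball _ hR.ne'] at hw
    simpa using hw
  · rw [closure_ball _ hR.ne']
    simpa using hz

lemma norm_multiset_prod (P : ℂ → ℂ) (M : Multiset ℂ) :
    ‖(M.map P).prod‖ = (M.map fun ρ ↦ ‖P ρ‖).prod := by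
  induction M using Multiset.induction with
  | empty => simp
  | cons a s ih => simp [ih]

lemma multiset_prod_le_pow {P : ℂ → ℝ} {b : ℝ} (h0 : ∀ ρ ∈ M, 0 ≤ P ρ) (h1 : ∀ ρ ∈ M, P ρ ≤ b) :
    (M.map P).prod ≤ b ^ M.card := by
  induction M using Multiset.induction with
  | empty => simp
  | cons a s ih =>
    simp only [Multiset.map_cons, Multiset.prod_cons, Multiset.card_cons, pow_succ']
    have ha0 := h0 a (by simp)
    have ha1 := h1 a (by simp)
    have := ih (fun ρ hρ ↦ h0 ρ (by simp [hρ])) (fun ρ hρ ↦ h1 ρ (by simp [hρ]))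
    have hs : 0 ≤ (s.map P).prod := Multiset.prod_nonneg (by
      intro x hx
      obtain ⟨ρ, hρ, rfl⟩ := Multiset.mem_map.mp hx
      exact h0 ρ (by simp [hρ]))
    exact mul_le_mul ha1 this hs (ha0.trans ha1)

lemma pow_le_multiset_prod {P : ℂ → ℝ} {b : ℝ} (hb : 0 ≤ b) (h1 : ∀ ρ ∈ M, b ≤ P ρ) :
    b ^ M.card ≤ (M.map P).prod := by
  induction M using Multiset.induction with
  | empty => simp
  | cons a s ih =>
    simp only [Multiset.map_cons, Multiset.prod_cons, Multiset.card_cons, pow_succ']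
    have ha1 := h1 a (by simp)
    have := ih (fun ρ hρ ↦ h1 ρ (by simp [hρ]))
    exact mul_le_mul ha1 this (by positivity) (hb.trans ha1)

lemma differentiable_multiset_prod {P : ℂ → ℂ → ℂ} (hP : ∀ ρ, Differentiable ℂ (P ρ)) :
    Differentiable ℂ fun z ↦ (M.map fun ρ ↦ P ρ z).prod := by
  induction M using Multiset.induction with
  | empty => simp
  | cons a s ih =>
    simp only [Multiset.map_cons, Multiset.prod_cons]
    exact (hP a).mul ih

/-- Jensen's bound for the number of zeros in a disc. -/
lemma pow_card_zeros_le (hr : 0 < r) (hR : r < R) (hg : Differentiable ℂ g)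
    (hM : ∀ ρ ∈ M, ‖ρ‖ ≤ r) (hf : ∀ z, f z = (M.map fun ρ ↦ z - ρ).prod * g z) (h0 : f 0 ≠ 0)
    (hb : ∀ z, ‖z‖ ≤ R → ‖f z‖ ≤ Real.exp L * ‖f 0‖) :
    (R / r) ^ M.card ≤ Real.exp L := by
  have hR0 : 0 < R := hr.trans hR
  have hg0 : g 0 ≠ 0 := fun h ↦ h0 (by simp [hf, h])
  have hRC : (R : ℂ) ≠ 0 := by exact_mod_cast hR0.ne'
  set G : ℂ → ℂ := fun z ↦ (M.map fun ρ ↦ (R ^ 2 - starRingEnd ℂ ρ * z) / R).prod * g z with hG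
  have hGd : Differentiable ℂ G := by
    refine Differentiable.mul (differentiable_multiset_prod
      (P := fun ρ z ↦ (R ^ 2 - starRingEnd ℂ ρ * z) / R) fun ρ ↦ ?_) hg
    exact (((differentiable_id.const_mul _).const_sub _).div_const _)
  have hsph : ∀ z, ‖z‖ = R → ‖G z‖ ≤ Real.exp L * ‖f 0‖ := by
    intro z hz
    refine le_of_eq_of_le ?_ (hb z hz.le)
    rw [hf, hG]
    simp only [norm_mul, norm_multiset_prod]
    congr 3
    ext ρ
    have h2 : (R : ℂ) ^ 2 = z * starRingEnd ℂ z := by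
      rw [mul_conj, normSq_eq_norm_sq, hz]; push_cast; rfl
    rw [h2, mul_comm _ z, ← mul_sub, ← map_sub, norm_div, norm_mul, RCLike.norm_conj, hz,
      norm_real, Real.norm_eq_abs, abs_of_pos hR0]
    field_simp
  have h1 := norm_le_of_sphere hR0 hGd hsph (z := 0) (by simpa using hR0.le)
  have h2 : ‖G 0‖ = R ^ M.card * ‖g 0‖ := by
    have h : (R : ℂ) ^ 2 / R = R := by field_simp
    simp only [hG, mul_zero, sub_zero, h, Multiset.map_const', Multiset.prod_replicate, norm_mul,
      norm_pow, norm_real, Real.norm_eq_abs, abs_of_pos hR0]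
  have h3 : ‖f 0‖ ≤ r ^ M.card * ‖g 0‖ := by
    rw [hf, norm_mul, norm_multiset_prod]
    gcongr
    exact multiset_prod_le_pow (fun _ _ ↦ norm_nonneg _) (fun ρ hρ ↦ by simpa using hM ρ hρ)
  rw [h2] at h1
  have h4 : R ^ M.card * ‖g 0‖ ≤ Real.exp L * r ^ M.card * ‖g 0‖ := by
    rw [mul_assoc]
    exact h1.trans (by gcongr)
  have h5 := le_of_mul_le_mul_right h4 (norm_pos_iff.mpr hg0)
  rw [div_pow, div_le_iff₀ (by positivity)]
  exact h5

lemma exists_factorization (hr : 0 < r) (hR : r < R) (hf : Differentiable ℂ f) (h0 : f 0 ≠ 0)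
    (hb : ∀ z, ‖z‖ ≤ R → ‖f z‖ ≤ Real.exp L * ‖f 0‖) :
    ∃ (M : Multiset ℂ) (g : ℂ → ℂ), Differentiable ℂ g ∧ (∀ ρ ∈ M, ‖ρ‖ ≤ r) ∧
      (∀ z, f z = (M.map fun ρ ↦ z - ρ).prod * g z) ∧ ∀ z, ‖z‖ ≤ r → g z ≠ 0 := by
  by_contra! hcon
  have hall : ∀ n : ℕ, ∃ (M : Multiset ℂ) (g : ℂ → ℂ), M.card = n ∧ Differentiable ℂ g ∧
      (∀ ρ ∈ M, ‖ρ‖ ≤ r) ∧ ∀ z, f z = (M.map fun ρ ↦ z - ρ).prod * g z := by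
    intro n
    induction n with
    | zero => exact ⟨0, f, by simp, hf, by simp, by simp⟩
    | succ n ih =>
      obtain ⟨M, g, hcard, hg, hM, hfg⟩ := ih
      obtain ⟨ρ, hρ, hgρ⟩ := hcon M g hg hM hfg
      refine ⟨ρ ::ₘ M, dslope g ρ, by simp [hcard], ?_, by simpa [hρ] using hM, fun z ↦ ?_⟩
      · rw [← differentiableOn_univ]
        exact (differentiableOn_dslope univ_mem).mpr hg.differentiableOn
      · have := sub_smul_dslope g ρ z
        rw [hgρ, sub_zero, smul_eq_mul] at this
        rw [hfg, ← this, Multiset.map_cons, Multiset.prod_cons]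
        ring
  have hone : 1 < R / r := (one_lt_div hr).mpr hR
  obtain ⟨n, hn⟩ := pow_unbounded_of_one_lt (Real.exp L) hone
  obtain ⟨M, g, rfl, hg, hM, hfg⟩ := hall n
  exact absurd (pow_card_zeros_le hr hR hg hM hfg h0 hb) (not_le.mpr hn)

lemma logDeriv_multiset_prod_mul (hg : Differentiable ℂ g) {z : ℂ} (hM : ∀ ρ ∈ M, z ≠ ρ)
    (hgz : g z ≠ 0) :
    logDeriv (fun z ↦ (M.map fun ρ ↦ z - ρ).prod * g z) z =
      (M.map fun ρ ↦ 1 / (z - ρ)).sum + logDeriv g z := by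
  induction M using Multiset.induction generalizing g with
  | empty => simp
  | cons a s ih =>
    have hza : z - a ≠ 0 := sub_ne_zero.mpr (hM a (by simp))
    have hrw : (fun z ↦ (((a ::ₘ s).map fun ρ ↦ z - ρ).prod * g z)) =
        fun z ↦ (s.map fun ρ ↦ z - ρ).prod * ((z - a) * g z) := by
      ext w; simp; ring
    have hd : Differentiable ℂ fun z ↦ z - a := differentiable_id.sub_const a
    rw [hrw, ih (g := fun z ↦ (z - a) * g z) (hd.mul hg) (fun ρ hρ ↦ hM ρ (by simp [hρ]))
      (mul_ne_zero hza hgz), logDeriv_mul z hza hgz (hd z) (hg z)]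
    simp only [Multiset.map_cons, Multiset.sum_cons]
    have : logDeriv (fun z ↦ z - a) z = 1 / (z - a) := by
      simp [logDeriv_apply]
    rw [this]
    ring

end Zeros

/-- Local partial fraction decomposition of the logarithmic derivative. -/
lemma exists_logDeriv_approx {r' r R : ℝ} (hr' : 0 < r') (hr : r' < r) (hR : r < R) :
    ∃ K : ℝ, 0 < K ∧ ∀ (f : ℂ → ℂ) (c : ℂ) (L : ℝ), Differentiable ℂ f → 0 < L → f c ≠ 0 →
      (∀ z, ‖z - c‖ ≤ R → ‖f z‖ ≤ Real.exp L * ‖f c‖) →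
      ∃ M : Multiset ℂ, (∀ ρ ∈ M, ‖ρ - c‖ ≤ r ∧ f ρ = 0) ∧ (M.card : ℝ) ≤ K * L ∧
        ∀ z, ‖z - c‖ ≤ r' → f z ≠ 0 →
          ‖logDeriv f z - (M.map fun ρ ↦ 1 / (z - ρ)).sum‖ ≤ K * L := by
  have hr0 : 0 < r := hr'.trans hr
  have hR0 : 0 < R := hr0.trans hR
  have hlog : 0 < Real.log (R / r) := Real.log_pos ((one_lt_div hr0).mpr hR)
  set K₁ : ℝ := 1 / Real.log (R / r) with hK₁
  have hK₁0 : 0 < K₁ := by positivity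
  set q : ℝ := |Real.log (r / (R - r))| with hq
  set K₂ : ℝ := 8 * r / (r - r') ^ 2 * (1 + K₁ * q) with hK₂
  have hrr : 0 < r - r' := by linarith
  have hRr : 0 < R - r := by linarith
  have hK₂0 : 0 < K₂ := by positivity
  refine ⟨K₁ + K₂, by positivity, fun f₀ c L hf₀ hL hc₀ hb₀ ↦ ?_⟩
  set f : ℂ → ℂ := fun z ↦ f₀ (z + c) with hf
  have hfd : Differentiable ℂ f := hf₀.comp (differentiable_id.add_const c)
  have hc : f 0 ≠ 0 := by simpa [hf] using hc₀
  have hb : ∀ z, ‖z‖ ≤ R → ‖f z‖ ≤ Real.exp L * ‖f 0‖ := fun z hz ↦ by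
    simpa [hf] using hb₀ (z + c) (by simpa using hz)
  obtain ⟨M, g, hg, hM, hfg, hg0⟩ := exists_factorization hr0 hR hfd hc hb
  have hcard : (M.card : ℝ) ≤ K₁ * L := by
    have := Real.log_le_log (by positivity) (pow_card_zeros_le hr0 hR hg hM hfg hc hb)
    rw [Real.log_exp, Real.log_pow] at this
    rw [hK₁, one_div_mul_eq_div, le_div_iff₀ hlog]
    exact this
  refine ⟨M.map (· + c), ?_, ?_, ?_⟩
  · intro ρ hρ
    obtain ⟨ρ', hρ', rfl⟩ := Multiset.mem_map.mp hρ
    refine ⟨by simpa using hM ρ' hρ', ?_⟩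
    have : f ρ' = 0 := by
      rw [hfg, Multiset.prod_eq_zero (Multiset.mem_map.mpr ⟨ρ', hρ', sub_self ρ'⟩), zero_mul]
    simpa [hf] using this
  · rw [Multiset.card_map]
    nlinarith
  · intro z₀ hz₀ hfz₀
    set z := z₀ - c with hz
    have hfz : f z ≠ 0 := by simpa [hf, hz] using hfz₀
    have hgb : ∀ w, ‖w‖ ≤ R → ‖g w‖ ≤ Real.exp (L * (1 + K₁ * q)) * ‖g 0‖ := by
      have h1 : ‖f 0‖ ≤ r ^ M.card * ‖g 0‖ := by
        rw [hfg, norm_mul, norm_multiset_prod]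
        gcongr
        exact multiset_prod_le_pow (fun _ _ ↦ norm_nonneg _) (fun ρ hρ ↦ by simpa using hM ρ hρ)
      intro w hw
      refine norm_le_of_sphere hR0 hg (fun u hu ↦ ?_) hw
      have h2 : (R - r) ^ M.card ≤ (M.map fun ρ ↦ ‖u - ρ‖).prod :=
        pow_le_multiset_prod hRr.le fun ρ hρ ↦ by
          have := norm_sub_norm_le u ρ
          have := hM ρ hρ
          linarith
      have h3 := hb u hu.le
      rw [hfg u, norm_mul, norm_multiset_prod] at h3
      have h4 : (R - r) ^ M.card * ‖g u‖ ≤ Real.exp L * (r ^ M.card * ‖g 0‖) :=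
        (mul_le_mul_of_nonneg_right h2 (norm_nonneg _)).trans (h3.trans (by gcongr))
      have h5 : ‖g u‖ ≤ Real.exp L * (r / (R - r)) ^ M.card * ‖g 0‖ := by
        rw [div_pow, ← mul_le_mul_iff_right₀ (show 0 < (R - r) ^ M.card by positivity)]
        refine h4.trans (le_of_eq ?_)
        field_simp
      refine h5.trans ?_
      rw [mul_add, mul_one, Real.exp_add]
      gcongr
      rw [← Real.exp_log (show 0 < r / (R - r) by positivity), ← Real.exp_nat_mul]
      refine Real.exp_le_exp.mpr ?_
      calc (M.card : ℝ) * Real.log (r / (R - r)) ≤ M.card * q := by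
            gcongr; exact le_abs_self _
        _ ≤ K₁ * L * q := by gcongr
        _ = L * (K₁ * q) := by ring
    have hz' : ‖z‖ ≤ r' := hz₀
    have hzM : ∀ ρ ∈ M, z ≠ ρ := by
      rintro ρ hρ rfl
      refine hfz ?_
      rw [hfg, Multiset.prod_eq_zero (Multiset.mem_map.mpr ⟨z, hρ, sub_self z⟩), zero_mul]
    have h6 := logDeriv_multiset_prod_mul (M := M) hg hzM (hg0 z (hz'.trans hr.le))
    have h7 : logDeriv f₀ z₀ = logDeriv f z := by
      simp only [logDeriv_apply, hf, hz, deriv_comp_add_const, sub_add_cancel]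
    have h8 := norm_logDeriv_le_of_norm_le_exp hr' hr (A := L * (1 + K₁ * q)) (by positivity) hg
      (fun w hw ↦ hg0 w (by simpa using (mem_ball_zero_iff.mp hw).le))
      (fun w hw ↦ hgb w ((mem_ball_zero_iff.mp hw).le.trans hR.le)) hz'
    rw [h7, show f = fun z ↦ (M.map fun ρ ↦ z - ρ).prod * g z from funext hfg, h6]
    have h9 : ((M.map (· + c)).map fun ρ ↦ 1 / (z₀ - ρ)).sum = (M.map fun ρ ↦ 1 / (z - ρ)).sum := by
      rw [Multiset.map_map]
      congr 2
      ext ρ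
      simp only [Function.comp_apply, hz]
      congr 1
      ring
    rw [h9, add_sub_cancel_left]
    refine h8.trans ?_
    have : 8 * r / (r - r') ^ 2 * (L * (1 + K₁ * q)) = K₂ * L := by rw [hK₂]; ring
    rw [this]
    nlinarith

lemma zetaReg_ne_zero (hRH : RiemannHypothesis) {s : ℂ} (hs : 1 / 2 < s.re) : zetaReg s ≠ 0 :=
  fun h ↦ hs.ne' (zetaReg_re_eq_half hRH (by linarith) h)

lemma one_le_log_abs_add_four (t : ℝ) : 1 ≤ Real.log (|t| + 4) := by
  rw [Real.le_log_iff_exp_le (by positivity)]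
  linarith [Real.exp_one_lt_d9, abs_nonneg t]

lemma exists_logDeriv_zetaReg_approx (hRH : RiemannHypothesis) :
    ∃ K : ℝ, 0 < K ∧ ∀ T : ℝ, ∃ M : Multiset ℂ, (∀ ρ ∈ M, ρ.re = 1 / 2) ∧
      (M.card : ℝ) ≤ K * Real.log (|T| + 4) ∧
      ∀ z : ℂ, ‖z - (2 + T * I)‖ ≤ 8 / 5 → zetaReg z ≠ 0 →
        ‖logDeriv zetaReg z - (M.map fun ρ ↦ 1 / (z - ρ)).sum‖ ≤ K * Real.log (|T| + 4) := by
  obtain ⟨K, hK, hmain⟩ := exists_logDeriv_approx (r' := 8 / 5) (r := 17 / 10) (R := 37 / 20)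
    (by norm_num) (by norm_num) (by norm_num)
  obtain ⟨C, hC, hCb⟩ := exists_norm_zetaReg_le (σ := 3 / 20) (by norm_num)
  obtain ⟨c, hc, hcb⟩ := exists_le_norm_zetaReg_two_add
  set A := |Real.log (4 * C / c)| + 2 with hA
  have hA0 : 0 < A := by positivity
  refine ⟨K * A, by positivity, fun T ↦ ?_⟩
  have hT := one_le_log_abs_add_four T
  have hT4 : 0 < |T| + 4 := by positivity
  set c₀ : ℂ := 2 + T * I with hc₀
  have hcre : c₀.re = 2 := by simp [hc₀]
  have hre : ∀ z : ℂ, |z.re - 2| ≤ ‖z - c₀‖ := fun z ↦ by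
    have := abs_re_le_norm (z - c₀)
    rwa [sub_re, hcre] at this
  have hne : zetaReg c₀ ≠ 0 := norm_pos_iff.mp (hc.trans_le (hcb T))
  have hbd : ∀ z : ℂ, ‖z - c₀‖ ≤ 37 / 20 →
      ‖zetaReg z‖ ≤ Real.exp (A * Real.log (|T| + 4)) * ‖zetaReg c₀‖ := by
    intro z hz
    have h1 := (hre z).trans hz
    rw [abs_le] at h1
    have h2 : ‖z‖ ≤ 37 / 20 + (2 + |T|) := by
      have h3 := norm_add_le (z - c₀) c₀
      rw [sub_add_cancel] at h3
      have h4 : ‖c₀‖ ≤ 2 + |T| := by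
        refine (norm_add_le _ _).trans ?_
        simp
      linarith
    have h5 : ‖zetaReg z‖ ≤ C * (2 * (|T| + 4)) ^ 2 := by
      refine (hCb z (by linarith)).trans ?_
      gcongr
      linarith [abs_nonneg T]
    refine h5.trans ?_
    have h6 : 4 * C / c ≤ Real.exp (|Real.log (4 * C / c)| * Real.log (|T| + 4)) := by
      rw [← Real.log_le_iff_le_exp (by positivity)]
      refine (le_abs_self _).trans ?_
      exact le_mul_of_one_le_right (abs_nonneg _) hT
    have h7 : Real.exp (A * Real.log (|T| + 4)) =
        Real.exp (|Real.log (4 * C / c)| * Real.log (|T| + 4)) * (|T| + 4) ^ 2 := by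
      rw [hA, add_mul, Real.exp_add, two_mul, Real.exp_add, Real.exp_log hT4]
      ring
    calc C * (2 * (|T| + 4)) ^ 2 = (4 * C / c) * (|T| + 4) ^ 2 * c := by field_simp; ring
      _ ≤ _ := by
        rw [h7]
        gcongr
        exact hcb T
  obtain ⟨M, hM1, hM2, hM3⟩ := hmain zetaReg c₀ (A * Real.log (|T| + 4)) differentiable_zetaReg
    (by positivity) hne hbd
  refine ⟨M, fun ρ hρ ↦ ?_, by rw [mul_assoc]; exact hM2, by simpa only [mul_assoc] using hM3⟩
  have h1 := (hre ρ).trans (hM1 ρ hρ).1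
  rw [abs_le] at h1
  exact zetaReg_re_eq_half hRH (by linarith) (hM1 ρ hρ).2

lemma norm_multiset_sum_le (P : ℂ → ℂ) (M : Multiset ℂ) {b : ℝ} (h : ∀ ρ ∈ M, ‖P ρ‖ ≤ b) :
    ‖(M.map P).sum‖ ≤ M.card * b := by
  induction M using Multiset.induction with
  | empty => simp
  | cons a s ih =>
    have := ih fun ρ hρ ↦ h ρ (by simp [hρ])
    have ha := h a (by simp)
    simp only [Multiset.map_cons, Multiset.sum_cons, Multiset.card_cons]
    refine (norm_add_le _ _).trans ?_
    push_cast
    linarith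

/-- Bound for `ζ'/ζ(s) + 1/(s-1)` to the right of the critical line. -/
lemma exists_norm_logDeriv_zetaReg_le (hRH : RiemannHypothesis) :
    ∃ K : ℝ, 0 < K ∧ ∀ σ t : ℝ, 1 / 2 < σ → σ ≤ 3 →
      ‖logDeriv zetaReg (σ + t * I)‖ ≤ K * Real.log (|t| + 4) * (1 + 1 / (σ - 1 / 2)) := by
  obtain ⟨K, hK, hmain⟩ := exists_logDeriv_zetaReg_approx hRH
  refine ⟨K, hK, fun σ t hσ hσ' ↦ ?_⟩
  obtain ⟨M, hM1, hM2, hM3⟩ := hmain t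
  have hs : ‖((σ : ℂ) + t * I) - (2 + t * I)‖ ≤ 8 / 5 := by
    have : ((σ : ℂ) + t * I) - (2 + t * I) = ((σ - 2 : ℝ) : ℂ) := by push_cast; ring
    rw [this, norm_real, Real.norm_eq_abs, abs_le]
    constructor <;> linarith
  have h1 := hM3 _ hs (zetaReg_ne_zero hRH (by simpa using hσ))
  have hσ0 : 0 < σ - 1 / 2 := by linarith
  have h2 := norm_multiset_sum_le (fun ρ ↦ 1 / ((σ : ℂ) + t * I - ρ)) M (b := 1 / (σ - 1 / 2))
    (fun ρ hρ ↦ by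
      rw [norm_div, norm_one]
      refine one_div_le_one_div_of_le hσ0 ?_
      refine le_trans ?_ (abs_re_le_norm _)
      refine le_trans (le_of_eq ?_) (le_abs_self _)
      simp [hM1 ρ hρ])
  have h3 := norm_add_le (logDeriv zetaReg (σ + t * I) -
    (M.map fun ρ ↦ 1 / ((σ : ℂ) + t * I - ρ)).sum) (M.map fun ρ ↦ 1 / ((σ : ℂ) + t * I - ρ)).sum
  rw [sub_add_cancel] at h3
  have h4 : (M.card : ℝ) * (1 / (σ - 1 / 2)) ≤ K * Real.log (|t| + 4) * (1 / (σ - 1 / 2)) := by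
    gcongr
  linarith

lemma continuous_poisson {δ : ℝ} (hδ : 0 < δ) (γ : ℝ) :
    Continuous fun t : ℝ ↦ δ / (δ ^ 2 + (t - γ) ^ 2) :=
  continuous_const.div (by fun_prop) fun t ↦ by positivity

lemma integral_poisson_le {δ : ℝ} (hδ : 0 < δ) (γ a b : ℝ) :
    ∫ t in a..b, δ / (δ ^ 2 + (t - γ) ^ 2) ≤ Real.pi := by
  have hd : ∀ t ∈ Set.uIcc a b,
      HasDerivAt (fun t ↦ Real.arctan ((t - γ) / δ)) (δ / (δ ^ 2 + (t - γ) ^ 2)) t := by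
    intro t _
    have := (((hasDerivAt_id' t).sub_const γ).div_const δ).arctan
    convert this using 1
    field_simp
  rw [intervalIntegral.integral_eq_sub_of_hasDerivAt hd
    ((continuous_poisson hδ γ).intervalIntegrable _ _)]
  have h1 := Real.arctan_lt_pi_div_two ((b - γ) / δ)
  have h2 := Real.neg_pi_div_two_lt_arctan ((a - γ) / δ)
  linarith

lemma sum_poisson {δ : ℝ} (hδ : 0 < δ) (M : Multiset ℂ) (a b : ℝ) :
    (Continuous fun t : ℝ ↦ (M.map fun ρ ↦ δ / (δ ^ 2 + (t - ρ.im) ^ 2)).sum) ∧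
      ∫ t in a..b, (M.map fun ρ ↦ δ / (δ ^ 2 + (t - ρ.im) ^ 2)).sum ≤ M.card * Real.pi := by
  induction M using Multiset.induction with
  | empty => simp [continuous_const]
  | cons x s ih =>
    simp only [Multiset.map_cons, Multiset.sum_cons, Multiset.card_cons]
    have hx := continuous_poisson hδ x.im
    refine ⟨hx.add ih.1, ?_⟩
    rw [intervalIntegral.integral_add (hx.intervalIntegrable _ _) (ih.1.intervalIntegrable _ _)]
    have := integral_poisson_le hδ x.im a b
    push_cast
    linarith [ih.2]

lemma continuous_logDeriv_zetaReg_line (hRH : RiemannHypothesis) {σ : ℝ} (hσ : 1 / 2 < σ) :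
    Continuous fun t : ℝ ↦ logDeriv zetaReg (σ + t * I) := by
  have h : Continuous fun t : ℝ ↦ (σ : ℂ) + t * I := by fun_prop
  refine Continuous.div (differentiable_zetaReg.deriv.continuous.comp h)
    (differentiable_zetaReg.continuous.comp h) fun t ↦ zetaReg_ne_zero hRH (by simpa using hσ)

lemma exists_integral_abs_re_logDeriv_zetaReg_le (hRH : RiemannHypothesis) :
    ∃ K : ℝ, 0 < K ∧ ∀ σ T : ℝ, 1 / 2 < σ → σ ≤ 3 →
      ∫ t in (T - 1 / 2)..(T + 1 / 2), |(logDeriv zetaReg (σ + t * I)).re| ≤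
        K * Real.log (|T| + 4) := by
  obtain ⟨K, hK, hmain⟩ := exists_logDeriv_zetaReg_approx hRH
  refine ⟨K * (1 + Real.pi), by positivity, fun σ T hσ hσ' ↦ ?_⟩
  obtain ⟨M, hM1, hM2, hM3⟩ := hmain T
  set δ := σ - 1 / 2 with hδ
  have hδ0 : 0 < δ := by linarith
  obtain ⟨hcont, hint⟩ := sum_poisson hδ0 M (T - 1 / 2) (T + 1 / 2)
  have hpt : ∀ t ∈ Set.Icc (T - 1 / 2) (T + 1 / 2), |(logDeriv zetaReg (σ + t * I)).re| ≤
      K * Real.log (|T| + 4) + (M.map fun ρ ↦ δ / (δ ^ 2 + (t - ρ.im) ^ 2)).sum := by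
    intro t ht
    have hs : ‖((σ : ℂ) + t * I) - (2 + T * I)‖ ≤ 8 / 5 := by
      rw [← sq_le_sq₀ (norm_nonneg _) (by norm_num), Complex.sq_norm, normSq_apply]
      simp
      nlinarith [ht.1, ht.2]
    have h1 := hM3 _ hs (zetaReg_ne_zero hRH (by simpa using hσ))
    have h2 : ((M.map fun ρ ↦ 1 / ((σ : ℂ) + t * I - ρ)).sum).re =
        (M.map fun ρ ↦ δ / (δ ^ 2 + (t - ρ.im) ^ 2)).sum := by
      rw [← Complex.coe_reAddGroupHom, map_multiset_sum, Multiset.map_map]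
      congr 1
      refine Multiset.map_congr rfl fun ρ hρ ↦ ?_
      simp only [Function.comp_apply, Complex.coe_reAddGroupHom, one_div, inv_re, normSq_apply]
      simp [hM1 ρ hρ, hδ]
      ring
    have h3 : 0 ≤ (M.map fun ρ ↦ δ / (δ ^ 2 + (t - ρ.im) ^ 2)).sum :=
      Multiset.sum_nonneg fun x hx ↦ by
        obtain ⟨ρ, -, rfl⟩ := Multiset.mem_map.mp hx
        positivity
    have h4 := (abs_re_le_norm _).trans h1
    rw [sub_re, h2] at h4
    rw [abs_le] at h4 ⊢
    constructor <;> linarith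
  have hcont' : Continuous fun t : ℝ ↦ K * Real.log (|T| + 4) +
      (M.map fun ρ ↦ δ / (δ ^ 2 + (t - ρ.im) ^ 2)).sum := continuous_const.add hcont
  refine (intervalIntegral.integral_mono_on (by linarith)
    ((continuous_abs.comp (continuous_re.comp
      (continuous_logDeriv_zetaReg_line hRH hσ))).intervalIntegrable _ _)
    (hcont'.intervalIntegrable _ _) hpt).trans ?_
  rw [intervalIntegral.integral_add (by simp) (hcont.intervalIntegrable _ _)]
  simp only [intervalIntegral.integral_const, smul_eq_mul]
  have h5 : (M.card : ℝ) * Real.pi ≤ K * Real.log (|T| + 4) * Real.pi := by gcongr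
  have h6 : (T + 1 / 2 - (T - 1 / 2)) = 1 := by ring
  rw [h6]
  linarith

lemma integrableOn_rpow_mul_exp {σ b : ℝ} (hσ : 0 < σ) (hb : 0 < b) :
    MeasureTheory.IntegrableOn (fun t : ℝ ↦ t ^ (σ - 1) * Real.exp (-(b * t))) (Ioi 0) := by
  simpa [neg_mul] using
    integrableOn_rpow_mul_exp_neg_mul_rpow (p := 1) (s := σ - 1) (b := b) (by linarith) one_pos hb

lemma norm_cpow_mul_exp {a r : ℂ} {t : ℝ} (ht : 0 < t) :
    ‖(t : ℂ) ^ (a - 1) * cexp (-(r * t))‖ = t ^ (a.re - 1) * Real.exp (-(r.re * t)) := by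
  rw [norm_mul, norm_cpow_eq_rpow_re_of_pos ht, norm_exp]
  simp

lemma measurable_cpow_mul_exp (a r : ℂ) :
    Measurable fun t : ℝ ↦ (t : ℂ) ^ (a - 1) * cexp (-(r * t)) := by fun_prop

lemma integrableOn_cpow_mul_exp {a r : ℂ} (ha : 0 < a.re) (hr : 0 < r.re) :
    MeasureTheory.IntegrableOn (fun t : ℝ ↦ (t : ℂ) ^ (a - 1) * cexp (-(r * t))) (Ioi 0) := by
  refine (integrableOn_rpow_mul_exp ha hr).mono'
    (measurable_cpow_mul_exp a r).aestronglyMeasurable ?_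
  filter_upwards [MeasureTheory.ae_restrict_mem measurableSet_Ioi] with t ht
  exact (norm_cpow_mul_exp ht).le

lemma differentiableAt_integral_cpow_mul_exp {a r : ℂ} (ha : 0 < a.re) (hr : 0 < r.re) :
    DifferentiableAt ℂ (fun r : ℂ ↦ ∫ t : ℝ in Ioi 0, (t : ℂ) ^ (a - 1) * cexp (-(r * t))) r := by
  have hs : {w : ℂ | r.re / 2 < w.re} ∈ 𝓝 r :=
    (isOpen_lt continuous_const continuous_re).mem_nhds (by simp; linarith)
  have hbound := integrableOn_rpow_mul_exp (σ := a.re + 1) (b := r.re / 2) (by linarith)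
    (by linarith)
  refine (hasDerivAt_integral_of_dominated_loc_of_deriv_le (𝕜 := ℂ)
    (F' := fun r (t : ℝ) ↦ (t : ℂ) ^ (a - 1) * (cexp (-(r * t)) * (-t))) hs
    (Eventually.of_forall fun w ↦ (measurable_cpow_mul_exp a w).aestronglyMeasurable)
    (integrableOn_cpow_mul_exp ha hr) ?_ ?_ hbound ?_).2.differentiableAt
  · exact Measurable.aestronglyMeasurable (by fun_prop)
  · filter_upwards [MeasureTheory.ae_restrict_mem measurableSet_Ioi] with t ht w hw
    have ht' : 0 < t := ht
    rw [← mul_assoc, norm_mul, norm_cpow_mul_exp ht, norm_neg, norm_real,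
      Real.norm_of_nonneg ht'.le,
      mul_right_comm, ← Real.rpow_add_one ht'.ne', sub_add_cancel, add_sub_cancel_right]
    have : r.re / 2 < w.re := hw
    gcongr
  · refine Eventually.of_forall fun t w _ ↦ ?_
    refine HasDerivAt.const_mul _ (HasDerivAt.cexp ?_)
    exact (hasDerivAt_mul_const (t : ℂ)).fun_neg

lemma integral_cpow_mul_exp_neg_mul {a r : ℂ} (ha : 0 < a.re) (hr : 0 < r.re) :
    ∫ t : ℝ in Ioi 0, (t : ℂ) ^ (a - 1) * cexp (-(r * t)) = (1 / r) ^ a * Gamma a := by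
  have hU : IsOpen {w : ℂ | 0 < w.re} := isOpen_lt continuous_const continuous_re
  have hf : AnalyticOnNhd ℂ
      (fun r : ℂ ↦ ∫ t : ℝ in Ioi 0, (t : ℂ) ^ (a - 1) * cexp (-(r * t))) {w | 0 < w.re} :=
    DifferentiableOn.analyticOnNhd
      (fun w hw ↦ (differentiableAt_integral_cpow_mul_exp ha hw).differentiableWithinAt) hU
  have hg : AnalyticOnNhd ℂ (fun r : ℂ ↦ (1 / r) ^ a * Gamma a) {w | 0 < w.re} := by
    refine DifferentiableOn.analyticOnNhd (fun w hw ↦ ?_) hU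
    have hw' : 0 < w.re := hw
    have hw0 : w ≠ 0 := fun h ↦ by simp [h] at hw'
    refine DifferentiableAt.differentiableWithinAt (DifferentiableAt.mul_const ?_ _)
    refine DifferentiableAt.cpow_const (by fun_prop (disch := assumption)) (Or.inl ?_)
    rw [one_div, inv_re]
    exact div_pos hw' (normSq_pos.mpr hw0)
  refine hf.eqOn_of_preconnected_of_frequently_eq hg (convex_halfSpace_re_gt 0).isPreconnected
    (z₀ := 1) (by simp) ?_ hr
  have ht : Tendsto (fun n : ℕ ↦ (((1 + 1 / ((n : ℝ) + 1)) : ℝ) : ℂ)) atTop (𝓝[≠] 1) := by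
    refine tendsto_nhdsWithin_iff.mpr ⟨?_, Eventually.of_forall fun n ↦ ?_⟩
    · have := (tendsto_one_div_add_atTop_nhds_zero_nat (𝕜 := ℝ)).const_add 1
      rw [add_zero] at this
      exact (continuous_ofReal.tendsto 1).comp this
    · have : (0 : ℝ) < 1 / ((n : ℝ) + 1) := by positivity
      simp only [Set.mem_compl_iff, Set.mem_singleton_iff, ofReal_eq_one]
      linarith
  refine ht.frequently (Frequently.of_forall fun n ↦ ?_)
  have := integral_cpow_mul_exp_neg_mul_Ioi (a := a) (r := 1 + 1 / ((n : ℝ) + 1)) ha (by positivity)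
  exact this

lemma mellin_exp_neg_mul {a r : ℂ} (ha : 0 < a.re) (hr : 0 < r.re) :
    mellin (fun t : ℝ ↦ cexp (-(r * t))) a = (1 / r) ^ a * Gamma a := by
  rw [mellin, ← integral_cpow_mul_exp_neg_mul ha hr]
  rfl

lemma mellinConvergent_exp_neg_mul {a r : ℂ} (ha : 0 < a.re) (hr : 0 < r.re) :
    MellinConvergent (fun t : ℝ ↦ cexp (-(r * t))) a :=
  integrableOn_cpow_mul_exp ha hr

lemma norm_one_div_cpow_mul_Gamma_le {a r : ℂ} (ha : 0 < a.re) (hr : 0 < r.re) :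
    ‖(1 / r) ^ a * Gamma a‖ ≤ (1 / r.re) ^ a.re * Real.Gamma a.re := by
  rw [← integral_cpow_mul_exp_neg_mul ha hr, ← Real.integral_rpow_mul_exp_neg_mul_Ioi ha hr]
  refine MeasureTheory.norm_integral_le_of_norm_le (integrableOn_rpow_mul_exp ha hr) ?_
  filter_upwards [MeasureTheory.ae_restrict_mem measurableSet_Ioi] with t ht
  exact (norm_cpow_mul_exp ht).le

lemma norm_one_div_cpow {z : ℂ} (hz : 0 < z.re) (s : ℂ) :
    ‖(1 / z) ^ s‖ = ‖z‖ ^ (-s.re) * Real.exp (z.arg * s.im) := by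
  have hz0 : z ≠ 0 := fun h ↦ by simp [h] at hz
  have harg : z.arg ≠ Real.pi := (mem_slitPlane_iff_arg.mp (Or.inl hz)).1
  rw [one_div, norm_cpow_of_ne_zero (inv_ne_zero hz0), norm_inv, arg_inv, if_neg harg,
    Real.inv_rpow (norm_nonneg _), Real.rpow_neg (norm_nonneg _), neg_mul, Real.exp_neg,
      div_inv_eq_mul]

/-- Exponential decay of the Gamma function on vertical lines. -/
lemma norm_Gamma_mul_exp_le {σ φ : ℝ} (t : ℝ) (hσ : 0 < σ) (hφ : |φ| < Real.pi / 2) :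
    ‖Gamma (σ + t * I)‖ * Real.exp (φ * t) ≤ (1 / Real.cos φ) ^ σ * Real.Gamma σ := by
  have hcos : 0 < Real.cos φ :=
    Real.cos_pos_of_mem_Ioo ⟨by linarith [(abs_lt.mp hφ).1], (abs_lt.mp hφ).2⟩
  have hre : (cexp (φ * I)).re = Real.cos φ := exp_ofReal_mul_I_re φ
  have h := norm_one_div_cpow_mul_Gamma_le (a := σ + t * I) (r := cexp (φ * I)) (by simpa using hσ)
    (by rwa [hre])
  rw [norm_mul, norm_one_div_cpow (by rwa [hre]), norm_exp_ofReal_mul_I, Real.one_rpow, one_mul,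
    arg_exp_mul_I, toIocMod_eq_self Real.two_pi_pos |>.mpr, hre, mul_comm] at h
  · simpa using h
  · have := abs_lt.mp hφ
    constructor <;> linarith [Real.pi_pos]

lemma norm_Gamma_half_mul_exp_le (t : ℝ) :
    ‖Gamma (1 / 2 + t * I)‖ * Real.exp (Real.pi / 2 * |t|) ≤ 3 := by
  have h1 := Complex.Gamma_mul_Gamma_one_sub (1 / 2 + t * I)
  have h2 : (1 : ℂ) - (1 / 2 + t * I) = (starRingEnd ℂ) (1 / 2 + t * I) := by
    apply Complex.ext <;> simp
    norm_num
  have h3 : Complex.sin (Real.pi * (1 / 2 + t * I)) = (Real.cosh (Real.pi * t) : ℝ) := by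
    rw [show (Real.pi : ℂ) * (1 / 2 + t * I) = ((Real.pi * t : ℝ) : ℂ) * I + Real.pi / 2 by
      push_cast; ring, Complex.sin_add_pi_div_two, Complex.cos_mul_I, ofReal_cosh]
  rw [h2, Gamma_conj, h3] at h1
  have h4 := congrArg norm h1
  rw [norm_mul, norm_conj, norm_div, norm_real, norm_real, Real.norm_of_nonneg Real.pi_pos.le,
    Real.norm_of_nonneg (Real.cosh_pos _).le] at h4
  have h5 : Real.exp (Real.pi * |t|) / 2 ≤ Real.cosh (Real.pi * t) := by
    rw [← Real.cosh_abs, abs_mul, abs_of_pos Real.pi_pos, Real.cosh_eq]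
    linarith [Real.exp_pos (-(Real.pi * |t|))]
  have h6 : Real.exp (Real.pi * |t|) = Real.exp (Real.pi / 2 * |t|) ^ 2 := by
    rw [← Real.exp_nat_mul]; congr 1; push_cast; ring
  refine abs_le_of_sq_le_sq' ?_ (by norm_num) |>.2
  rw [mul_pow, ← h6, sq, h4, div_mul_eq_mul_div, div_le_iff₀ (Real.cosh_pos _)]
  nlinarith [Real.pi_lt_d2, Real.pi_pos, Real.cosh_pos (Real.pi * t)]

lemma exists_norm_Gamma_quarter_mul_exp_le :
    ∃ C : ℝ, 0 < C ∧ ∀ t : ℝ, ‖Gamma (1 / 4 + t * I)‖ * Real.exp (Real.pi / 2 * |t|) ≤ C := by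
  have hΓ : 0 < Real.Gamma (1 / 4) := Real.Gamma_pos_of_pos (by norm_num)
  have hΓ' : ‖Gamma (1 / 4)‖ = Real.Gamma (1 / 4) := by
    have := Complex.Gamma_ofReal (1 / 4)
    push_cast at this
    rw [this, norm_real, Real.norm_of_nonneg hΓ.le]
  set B := ∫ x in (0 : ℝ)..1, ‖(x : ℂ) ^ ((1 / 4 : ℂ) - 1) * (1 - (x : ℂ)) ^ ((1 / 4 : ℂ) - 1)‖
    with hB
  have hB0 : 0 ≤ B := intervalIntegral.integral_nonneg zero_le_one fun _ _ ↦ norm_nonneg _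
  have hbeta : ∀ t : ℝ, ‖betaIntegral (1 / 4 + t * I) (1 / 4)‖ ≤ B := by
    intro t
    refine (intervalIntegral.norm_integral_le_integral_norm zero_le_one).trans (le_of_eq ?_)
    refine intervalIntegral.integral_congr_ae (Eventually.of_forall fun x hx ↦ ?_)
    rw [uIoc_of_le zero_le_one] at hx
    rw [norm_mul, norm_mul, norm_cpow_eq_rpow_re_of_pos hx.1, norm_cpow_eq_rpow_re_of_pos hx.1]
    simp
  refine ⟨3 * (B + 1) / Real.Gamma (1 / 4), by positivity, fun t ↦ ?_⟩
  have h1 := Gamma_mul_Gamma_eq_betaIntegral (s := 1 / 4 + t * I) (t := 1 / 4) (by simp) (by simp)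
  have h2 := congrArg norm h1
  rw [norm_mul, hΓ', norm_mul, show (1 / 4 : ℂ) + t * I + 1 / 4 = 1 / 2 + t * I by ring] at h2
  rw [le_div_iff₀ hΓ, mul_right_comm, h2, mul_right_comm]
  have := norm_Gamma_half_mul_exp_le t
  have := hbeta t
  gcongr
  linarith

lemma norm_Gamma_three_halves_mul_exp_le (t : ℝ) :
    ‖Gamma (3 / 2 + t * I)‖ * Real.exp (Real.pi / 2 * |t|) ≤ 3 * (1 / 2 + |t|) := by
  have h0 : (1 / 2 : ℂ) + t * I ≠ 0 := fun h ↦ by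
    have := congrArg re h
    simp at this
  have h1 : Gamma (3 / 2 + t * I) = (1 / 2 + t * I) * Gamma (1 / 2 + t * I) := by
    rw [← Gamma_add_one _ h0]
    congr 1
    ring
  have h2 : ‖(1 / 2 : ℂ) + t * I‖ ≤ 1 / 2 + |t| := by
    refine (norm_add_le _ _).trans ?_
    simp
  rw [h1, norm_mul, mul_assoc, mul_comm]
  have := norm_Gamma_half_mul_exp_le t
  gcongr

lemma norm_Gamma_half_add_mul_exp_le {φ δ : ℝ} (t : ℝ) (hφ : |φ| < Real.pi / 2) (hδ : 0 ≤ δ)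
    (hδ1 : δ ≤ 1) :
    ‖Gamma ((1 / 2 + δ : ℝ) + t * I)‖ * Real.exp (φ * t) ≤
      6 * (1 / (Real.pi / 2 - |φ|)) ^ δ := by
  set η := Real.pi / 2 - |φ| with hη
  have hη0 : 0 < η := by linarith
  have hη2 : η ≤ 2 := by linarith [abs_nonneg φ, Real.pi_lt_d2]
  set f : ℂ → ℂ := fun w ↦ Gamma w * cexp (-(φ * I * w)) with hf
  have hnorm : ∀ w : ℂ, ‖f w‖ = ‖Gamma w‖ * Real.exp (φ * w.im) := fun w ↦ by
    rw [hf, norm_mul, norm_exp]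
    simp
  have hexp : ∀ s : ℝ, Real.exp (φ * s) ≤ Real.exp (Real.pi / 2 * |s|) * Real.exp (-(η * |s|)) := by
    intro s
    rw [← Real.exp_add, Real.exp_le_exp]
    have := le_abs_self (φ * s)
    rw [abs_mul] at this
    rw [hη]
    linarith
  have hdiff : DifferentiableOn ℂ f {w | 0 < w.re} := by
    intro w hw
    have hw' : 0 < w.re := hw
    refine DifferentiableAt.differentiableWithinAt (DifferentiableAt.mul
      (differentiableAt_Gamma w fun m h ↦ ?_) (by fun_prop))
    rw [h] at hw'
    simp at hw'
    linarith [m.cast_nonneg (α := ℝ)]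
  have hle : ∀ σ s : ℝ, 0 < σ → ‖f (σ + s * I)‖ ≤ (1 / Real.cos φ) ^ σ * Real.Gamma σ := by
    intro σ s hσ
    rw [hnorm]
    simpa using norm_Gamma_mul_exp_le s hσ hφ
  have hcos : 0 < Real.cos φ :=
    Real.cos_pos_of_mem_Ioo ⟨by linarith [(abs_lt.mp hφ).1], (abs_lt.mp hφ).2⟩
  have hbdd : BddAbove ((norm ∘ f) '' HadamardThreeLines.verticalClosedStrip (1 / 2) (3 / 2)) := by
    have hc : ContinuousOn (fun σ : ℝ ↦ (1 / Real.cos φ) ^ σ * Real.Gamma σ)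
        (Icc (1 / 2) (3 / 2)) := by
      refine ContinuousOn.mul ?_ ?_
      · exact (Real.continuous_const_rpow (by positivity)).continuousOn
      · intro σ hσ
        refine (Real.differentiableAt_Gamma fun m h ↦ ?_).continuousAt.continuousWithinAt
        linarith [m.cast_nonneg (α := ℝ), hσ.1]
    obtain ⟨B, hB⟩ := isCompact_Icc.bddAbove_image hc
    refine ⟨B, ?_⟩
    rintro _ ⟨w, hw, rfl⟩
    have hw' : w.re ∈ Icc (1 / 2 : ℝ) (3 / 2) := hw
    have := hle w.re w.im (by linarith [hw'.1])
    rw [re_add_im] at this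
    exact this.trans (hB ⟨_, hw', rfl⟩)
  have hcl : DiffContOnCl ℂ f (HadamardThreeLines.verticalStrip (1 / 2) (3 / 2)) := by
    refine DifferentiableOn.diffContOnCl (hdiff.mono ?_)
    refine (closure_minimal (t := re ⁻¹' Icc (1 / 2) (3 / 2)) ?_ ?_).trans ?_
    · exact preimage_mono Ioo_subset_Icc_self
    · exact isClosed_Icc.preimage continuous_re
    · intro w hw
      have : (1 / 2 : ℝ) ≤ w.re := hw.1
      show 0 < w.re
      linarith
  have ha : ∀ w ∈ re ⁻¹' {(1 / 2 : ℝ)}, ‖f w‖ ≤ 3 := by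
    intro w hw
    have hw' : w.re = 1 / 2 := hw
    have h1 := norm_Gamma_half_mul_exp_le w.im
    have h2 : (1 / 2 : ℂ) + w.im * I = w := by
      conv_rhs => rw [← re_add_im w, hw']
      push_cast
      rfl
    rw [h2] at h1
    rw [hnorm]
    refine le_trans (mul_le_mul_of_nonneg_left ?_ (norm_nonneg _)) h1
    refine (hexp _).trans (mul_le_of_le_one_right (Real.exp_pos _).le ?_)
    rw [Real.exp_le_one_iff]
    have : 0 ≤ η * |w.im| := by positivity
    linarith
  have hb : ∀ w ∈ re ⁻¹' {(3 / 2 : ℝ)}, ‖f w‖ ≤ 6 / η := by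
    intro w hw
    have hw' : w.re = 3 / 2 := hw
    have h1 := norm_Gamma_three_halves_mul_exp_le w.im
    have h2 : (3 / 2 : ℂ) + w.im * I = w := by
      conv_rhs => rw [← re_add_im w, hw']
      push_cast
      rfl
    rw [h2] at h1
    have h3 : ‖f w‖ ≤ 3 * (1 / 2 + |w.im|) * Real.exp (-(η * |w.im|)) := by
      rw [hnorm]
      calc _ ≤ ‖Gamma w‖ * (Real.exp (Real.pi / 2 * |w.im|) * Real.exp (-(η * |w.im|))) := by
            gcongr
            exact hexp _
        _ ≤ _ := by
            rw [← mul_assoc]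
            gcongr
    refine h3.trans ?_
    rw [Real.exp_neg, ← div_eq_mul_inv, div_le_div_iff₀ (Real.exp_pos _) hη0]
    have h4 := Real.add_one_le_exp (η * |w.im|)
    have h5 : 0 ≤ η * |w.im| := by positivity
    nlinarith
  have hz : ((1 / 2 + δ : ℝ) + t * I : ℂ) ∈
      HadamardThreeLines.verticalClosedStrip (1 / 2) (3 / 2) := by
    show ((1 / 2 + δ : ℝ) + t * I : ℂ).re ∈ Icc (1 / 2 : ℝ) (3 / 2)
    simp only [add_re, ofReal_re, mul_re, I_re, ofReal_im, I_im]
    constructor <;> linarith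
  have h := HadamardThreeLines.norm_le_interp_of_mem_verticalClosedStrip' (by norm_num) hz hcl hbdd
    ha hb
  rw [hnorm] at h
  have hre : ((1 / 2 + δ : ℝ) + t * I : ℂ).re = 1 / 2 + δ := by simp
  have him : ((1 / 2 + δ : ℝ) + t * I : ℂ).im = t := by simp
  rw [hre, him, show (1 / 2 + δ - 1 / 2) / (3 / 2 - 1 / 2) = δ by ring] at h
  refine h.trans ?_
  rw [show 6 / η = 3 * (2 * (1 / η)) by ring, Real.mul_rpow (by norm_num) (by positivity),
    Real.mul_rpow (by norm_num) (by positivity), ← mul_assoc, ← Real.rpow_add (by norm_num),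
    sub_add_cancel, Real.rpow_one, ← mul_assoc]
  have h2 : (2 : ℝ) ^ δ ≤ 2 := by
    simpa using Real.rpow_le_rpow_of_exponent_le (x := 2) (by norm_num) hδ1
  gcongr
  linarith

lemma integrable_div_one_add_sq (B : ℝ) : MeasureTheory.Integrable fun t : ℝ ↦ B / (1 + t ^ 2) := by
  simpa only [div_eq_mul_inv] using integrable_inv_one_add_sq.const_mul B

lemma continuous_vertical {f : ℂ → ℂ} {a b σ : ℝ} (hf : ContinuousOn f (re ⁻¹' Icc a b))
    (hσ : σ ∈ Icc a b) : Continuous fun t : ℝ ↦ f (σ + t * I) :=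
  hf.comp_continuous (by fun_prop) fun t ↦ by simpa using hσ

lemma integrable_vertical {f : ℂ → ℂ} {a b B σ : ℝ} (hf : ContinuousOn f (re ⁻¹' Icc a b))
    (hb : ∀ σ ∈ Icc a b, ∀ t : ℝ, ‖f (σ + t * I)‖ ≤ B / (1 + t ^ 2)) (hσ : σ ∈ Icc a b) :
    MeasureTheory.Integrable fun t : ℝ ↦ f (σ + t * I) :=
  (integrable_div_one_add_sq B).mono' (continuous_vertical hf hσ).aestronglyMeasurable
    (Eventually.of_forall fun t ↦ hb σ hσ t)

lemma integral_vertical_eq {f : ℂ → ℂ} {a b B : ℝ} (hab : a ≤ b)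
    (hf : DifferentiableOn ℂ f (re ⁻¹' Icc a b))
    (hb : ∀ σ ∈ Icc a b, ∀ t : ℝ, ‖f (σ + t * I)‖ ≤ B / (1 + t ^ 2)) :
    ∫ t : ℝ, f (a + t * I) = ∫ t : ℝ, f (b + t * I) := by
  have hrect : ∀ T : ℝ, (∫ x : ℝ in a..b, f (x + (-T : ℝ) * I)) - (∫ x : ℝ in a..b, f (x + T * I)) +
      I • (∫ y : ℝ in (-T)..T, f (b + y * I)) - I • (∫ y : ℝ in (-T)..T, f (a + y * I)) = 0 := by
    intro T
    have := integral_boundary_rect_eq_zero_of_differentiableOn f ⟨a, -T⟩ ⟨b, T⟩ (hf.mono ?_)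
    · exact this
    · intro w hw
      have h1 : w.re ∈ Set.uIcc a b := hw.1
      rwa [uIcc_of_le hab] at h1
  have hhor : ∀ ε : ℝ, |ε| = 1 →
      Tendsto (fun T : ℝ ↦ ∫ x : ℝ in a..b, f (x + (ε * T : ℝ) * I)) atTop (𝓝 0) := by
    intro ε hε
    have hε2 : ε ^ 2 = 1 := by rw [← sq_abs, hε, one_pow]
    have h1 : Tendsto (fun T : ℝ ↦ B / (1 + T ^ 2) * |b - a|) atTop (𝓝 0) := by
      have h2 : Tendsto (fun T : ℝ ↦ 1 + T ^ 2) atTop atTop :=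
        tendsto_atTop_add_const_left _ _ (tendsto_pow_atTop two_ne_zero)
      simpa using (h2.const_div_atTop B).mul_const |b - a|
    refine squeeze_zero_norm (fun T ↦ ?_) h1
    refine intervalIntegral.norm_integral_le_of_norm_le_const fun x hx ↦ ?_
    rw [uIoc_of_le hab] at hx
    have := hb x ⟨hx.1.le, hx.2⟩ (ε * T)
    rwa [mul_pow, hε2, one_mul] at this
  have hver : ∀ σ ∈ Icc a b, Tendsto (fun T : ℝ ↦ ∫ y : ℝ in (-T)..T, f (σ + y * I)) atTop
      (𝓝 (∫ y : ℝ, f (σ + y * I))) := fun σ hσ ↦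
    MeasureTheory.intervalIntegral_tendsto_integral (integrable_vertical hf.continuousOn hb hσ)
      tendsto_neg_atTop_atBot tendsto_id
  have h1 := (((hhor (-1) (by simp)).sub (hhor 1 (by simp))).add
    ((hver b ⟨hab, le_rfl⟩).const_smul I)).sub ((hver a ⟨le_rfl, hab⟩).const_smul I)
  simp only [neg_one_mul, one_mul, hrect] at h1
  have h2 := tendsto_nhds_unique tendsto_const_nhds h1
  rw [sub_zero, zero_add, ← smul_sub, eq_comm, smul_eq_zero, sub_eq_zero] at h2
  exact (h2.resolve_left I_ne_zero).symm

/-- The Mellin transform of `t ↦ exp (-z t)`. -/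
noncomputable def gammaKernel (z s : ℂ) : ℂ := (1 / z) ^ s * Gamma s

lemma ne_zero_of_re_pos {z : ℂ} (hz : 0 < z.re) : z ≠ 0 := fun h ↦ by simp [h] at hz

lemma differentiableAt_gammaKernel {z s : ℂ} (hz : 0 < z.re) (hs : 0 < s.re) :
    DifferentiableAt ℂ (gammaKernel z) s := by
  refine DifferentiableAt.mul ?_ (differentiableAt_Gamma s fun m h ↦ ?_)
  · exact differentiableAt_id.const_cpow (Or.inl (one_div_ne_zero (ne_zero_of_re_pos hz)))
  · rw [h] at hs
    simp at hs
    linarith [m.cast_nonneg (α := ℝ)]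

lemma norm_gammaKernel {z : ℂ} (hz : 0 < z.re) (σ t : ℝ) :
    ‖gammaKernel z (σ + t * I)‖ =
      ‖z‖ ^ (-σ) * Real.exp (z.arg * t) * ‖Gamma (σ + t * I)‖ := by
  rw [gammaKernel, norm_mul, norm_one_div_cpow hz]
  simp

lemma norm_gammaKernel_le {z : ℂ} (hz : 0 < z.re) {σ t φ C : ℝ}
    (h : ‖Gamma (σ + t * I)‖ * Real.exp (φ * |t|) ≤ C) :
    ‖gammaKernel z (σ + t * I)‖ ≤ ‖z‖ ^ (-σ) * C * Real.exp (-((φ - |z.arg|) * |t|)) := by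
  have h1 : Real.exp (z.arg * t) ≤ Real.exp (φ * |t|) * Real.exp (-((φ - |z.arg|) * |t|)) := by
    rw [← Real.exp_add, Real.exp_le_exp]
    have := le_abs_self (z.arg * t)
    rw [abs_mul] at this
    linarith
  rw [norm_gammaKernel hz]
  calc _ ≤ ‖z‖ ^ (-σ) * (Real.exp (φ * |t|) * Real.exp (-((φ - |z.arg|) * |t|))) *
        ‖Gamma (σ + t * I)‖ := by gcongr
    _ = ‖z‖ ^ (-σ) * (‖Gamma (σ + t * I)‖ * Real.exp (φ * |t|)) *
        Real.exp (-((φ - |z.arg|) * |t|)) := by ring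
    _ ≤ _ := by gcongr

lemma norm_Gamma_mul_exp_abs_le {σ φ : ℝ} (t : ℝ) (hσ : 0 < σ) (hφ0 : 0 ≤ φ)
    (hφ : φ < Real.pi / 2) :
    ‖Gamma (σ + t * I)‖ * Real.exp (φ * |t|) ≤ (1 / Real.cos φ) ^ σ * Real.Gamma σ := by
  rcases abs_cases t with ⟨h, -⟩ | ⟨h, -⟩ <;> rw [h]
  · exact norm_Gamma_mul_exp_le t hσ (by rwa [abs_of_nonneg hφ0])
  · rw [mul_neg, ← neg_mul]
    simpa using norm_Gamma_mul_exp_le (φ := -φ) t hσ (by rwa [abs_neg, abs_of_nonneg hφ0])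

lemma log_mul_exp_le {c : ℝ} (hc : 0 < c) (t : ℝ) :
    Real.log (|t| + 4) * Real.exp (-(c * |t|)) ≤
      6 * Real.exp (4 * c) / c ^ 3 / (1 + t ^ 2) := by
  have h0 := abs_nonneg t
  have h1 : Real.log (|t| + 4) ≤ |t| + 4 := Real.log_le_self (by positivity)
  have h2 := Real.pow_div_factorial_le_exp (c * (|t| + 4)) (by positivity) 3
  rw [mul_pow, div_le_iff₀ (by positivity), show c * (|t| + 4) = c * |t| + 4 * c by ring,
    Real.exp_add] at h2
  have h3 : 1 + t ^ 2 ≤ (|t| + 4) ^ 2 := by nlinarith [sq_abs t]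
  rw [Real.exp_neg, ← div_eq_mul_inv, div_div, div_le_div_iff₀ (Real.exp_pos _) (by positivity)]
  calc Real.log (|t| + 4) * (c ^ 3 * (1 + t ^ 2)) ≤ (|t| + 4) * (c ^ 3 * (|t| + 4) ^ 2) := by gcongr
    _ = c ^ 3 * (|t| + 4) ^ 3 := by ring
    _ ≤ _ := h2
    _ = _ := by norm_num [Nat.factorial]; ring

lemma exists_log_mul_norm_gammaKernel_le {z : ℂ} (hz : 0 < z.re) {a : ℝ} (ha : 0 < a) (b : ℝ) :
    ∃ B : ℝ, 0 ≤ B ∧ ∀ σ ∈ Icc a b, ∀ t : ℝ,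
      Real.log (|t| + 4) * ‖gammaKernel z (σ + t * I)‖ ≤ B / (1 + t ^ 2) := by
  have harg : |z.arg| < Real.pi / 2 := abs_arg_lt_pi_div_two_iff.mpr (Or.inl hz)
  have hz0 := ne_zero_of_re_pos hz
  set φ := (|z.arg| + Real.pi / 2) / 2 with hφ
  have hφ1 : φ < Real.pi / 2 := by linarith
  have hφ0 : 0 ≤ φ := by positivity
  have hc : 0 < φ - |z.arg| := by linarith
  have hcos : 0 < Real.cos φ := Real.cos_pos_of_mem_Ioo ⟨by linarith [Real.pi_pos], hφ1⟩
  have hcont : ContinuousOn (fun σ : ℝ ↦ ‖z‖ ^ (-σ) * ((1 / Real.cos φ) ^ σ * Real.Gamma σ))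
      (Icc a b) := by
    refine ContinuousOn.mul ?_ (ContinuousOn.mul ?_ ?_)
    · exact ((Real.continuous_const_rpow (norm_ne_zero_iff.mpr hz0)).comp continuous_neg)
          |>.continuousOn
    · exact (Real.continuous_const_rpow (by positivity)).continuousOn
    · intro σ hσ
      refine (Real.differentiableAt_Gamma fun m h ↦ ?_).continuousAt.continuousWithinAt
      linarith [m.cast_nonneg (α := ℝ), hσ.1]
  obtain ⟨D, hD⟩ := isCompact_Icc.bddAbove_image hcont
  refine ⟨max D 0 * (6 * Real.exp (4 * (φ - |z.arg|)) / (φ - |z.arg|) ^ 3), by positivity,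
    fun σ hσ t ↦ ?_⟩
  have hσ0 : 0 < σ := ha.trans_le hσ.1
  have h1 := norm_gammaKernel_le hz (norm_Gamma_mul_exp_abs_le t hσ0 hφ0 hφ1)
  have h2 : ‖z‖ ^ (-σ) * ((1 / Real.cos φ) ^ σ * Real.Gamma σ) ≤ max D 0 :=
    (hD ⟨σ, hσ, rfl⟩).trans (le_max_left _ _)
  have hlog : 0 ≤ Real.log (|t| + 4) := zero_le_one.trans (one_le_log_abs_add_four t)
  calc _ ≤ Real.log (|t| + 4) * (max D 0 * Real.exp (-((φ - |z.arg|) * |t|))) := by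
        refine mul_le_mul_of_nonneg_left (h1.trans ?_) hlog
        gcongr
    _ = max D 0 * (Real.log (|t| + 4) * Real.exp (-((φ - |z.arg|) * |t|))) := by ring
    _ ≤ max D 0 * (6 * Real.exp (4 * (φ - |z.arg|)) / (φ - |z.arg|) ^ 3 / (1 + t ^ 2)) := by
        gcongr
        exact log_mul_exp_le hc t
    _ = _ := by ring

lemma exists_norm_gammaKernel_le {z : ℂ} (hz : 0 < z.re) {a : ℝ} (ha : 0 < a) (b : ℝ) :
    ∃ B : ℝ, 0 ≤ B ∧ ∀ σ ∈ Icc a b, ∀ t : ℝ, ‖gammaKernel z (σ + t * I)‖ ≤ B / (1 + t ^ 2) := by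
  obtain ⟨B, hB, h⟩ := exists_log_mul_norm_gammaKernel_le hz ha b
  exact ⟨B, hB, fun σ hσ t ↦ (le_mul_of_one_le_left (norm_nonneg _)
    (one_le_log_abs_add_four t)).trans (h σ hσ t)⟩

lemma continuousOn_gammaKernel {z : ℂ} (hz : 0 < z.re) {a : ℝ} (ha : 0 < a) (b : ℝ) :
    ContinuousOn (gammaKernel z) (re ⁻¹' Icc a b) := fun _ hs ↦
  (differentiableAt_gammaKernel hz (ha.trans_le hs.1)).continuousAt.continuousWithinAt

lemma integrable_gammaKernel {z : ℂ} (hz : 0 < z.re) {σ : ℝ} (hσ : 0 < σ) :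
    MeasureTheory.Integrable fun t : ℝ ↦ gammaKernel z (σ + t * I) := by
  obtain ⟨B, -, hB⟩ := exists_norm_gammaKernel_le hz hσ σ
  exact integrable_vertical (continuousOn_gammaKernel hz hσ σ) hB ⟨le_rfl, le_rfl⟩

lemma exp_neg_mul_eq_integral {z : ℂ} (hz : 0 < z.re) {σ x : ℝ} (hσ : 0 < σ) (hx : 0 < x) :
    cexp (-(z * x)) = (1 / (2 * Real.pi) : ℝ) •
      ∫ t : ℝ, (x : ℂ) ^ (-(σ + t * I)) * gammaKernel z (σ + t * I) := by
  have hm : ∀ t : ℝ, mellin (fun t : ℝ ↦ cexp (-(z * t))) (σ + t * I) =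
      gammaKernel z (σ + t * I) := fun t ↦ mellin_exp_neg_mul (by simpa using hσ) hz
  have h := mellinInv_mellin_eq σ (fun t : ℝ ↦ cexp (-(z * t))) hx
    (mellinConvergent_exp_neg_mul (by simpa using hσ) hz) ?_ (by fun_prop)
  · rw [← h, mellinInv]
    simp only [hm, smul_eq_mul]
  · simpa only [VerticalIntegrable, hm] using integrable_gammaKernel hz hσ

lemma logDeriv_zetaReg_eq {s : ℂ} (hs : 1 < s.re) :
    logDeriv zetaReg s = 1 / (s - 1) -
      LSeries (fun n ↦ (ArithmeticFunction.vonMangoldt n : ℂ)) s := by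
  have hs1 : s ≠ 1 := by rintro rfl; simp at hs
  have h : zetaReg =ᶠ[𝓝 s] fun s ↦ (s - 1) * riemannZeta s := by
    filter_upwards [isOpen_ne.mem_nhds hs1] with w hw using zetaReg_of_ne hw
  have h1 : logDeriv zetaReg s = logDeriv (fun s ↦ (s - 1) * riemannZeta s) s := by
    rw [logDeriv_apply, logDeriv_apply, h.deriv_eq, h.eq_of_nhds]
  rw [h1, logDeriv_mul (f := fun s ↦ s - 1) s (sub_ne_zero.mpr hs1)
    (riemannZeta_ne_zero_of_one_lt_re hs) (by fun_prop) (differentiableAt_riemannZeta hs1),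
    ArithmeticFunction.LSeries_vonMangoldt_eq_deriv_riemannZeta_div hs, logDeriv_apply,
    logDeriv_apply]
  simp
  ring

lemma hasSum_vonMangoldt_mul_exp {z : ℂ} (hz : 0 < z.re) :
    HasSum (fun n : ℕ ↦ (ArithmeticFunction.vonMangoldt n : ℂ) * cexp (-(z * n)))
      ((1 / (2 * Real.pi) : ℝ) • ∫ t : ℝ,
        LSeries (fun n ↦ (ArithmeticFunction.vonMangoldt n : ℂ)) ((2 : ℝ) + t * I) *
          gammaKernel z ((2 : ℝ) + t * I)) := by
  set f : ℕ → ℂ := fun n ↦ (ArithmeticFunction.vonMangoldt n : ℂ) with hf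
  set k : ℝ → ℂ := fun t ↦ gammaKernel z ((2 : ℝ) + t * I) with hk
  have hkint : MeasureTheory.Integrable k := integrable_gammaKernel hz two_pos
  have hcont : ∀ n : ℕ, Continuous fun t : ℝ ↦ LSeries.term f ((2 : ℝ) + t * I) n := by
    intro n
    rcases eq_or_ne n 0 with rfl | hn
    · simpa using continuous_const
    · simp only [LSeries.term_of_ne_zero hn]
      have hn' : (n : ℂ) ≠ 0 := by exact_mod_cast hn
      refine continuous_const.div ?_ fun t ↦ ?_
      · exact Continuous.const_cpow (by fun_prop) (Or.inl hn')
      · simp [cpow_eq_zero_iff, hn']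
  have hnorm : ∀ (n : ℕ) (t : ℝ),
      ‖LSeries.term f ((2 : ℝ) + t * I) n‖ = ‖LSeries.term f 2 n‖ := by
    intro n t
    simp [LSeries.norm_term_eq]
  have hint : ∀ n : ℕ, MeasureTheory.Integrable
      fun t : ℝ ↦ LSeries.term f ((2 : ℝ) + t * I) n * k t := fun n ↦
    hkint.bdd_mul (hcont n).aestronglyMeasurable (Eventually.of_forall fun t ↦ (hnorm n t).le)
  have hsum := MeasureTheory.hasSum_integral_of_summable_integral_norm hint (by
    simp only [norm_mul, hnorm, MeasureTheory.integral_const_mul]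
    exact (ArithmeticFunction.LSeriesSummable_vonMangoldt (s := 2) (by simp)).norm.mul_right _)
  have hsum' := hsum.const_smul (1 / (2 * Real.pi) : ℝ)
  simp only [tsum_mul_right] at hsum'
  have hterm : ∀ n : ℕ, (ArithmeticFunction.vonMangoldt n : ℂ) * cexp (-(z * n)) =
      (1 / (2 * Real.pi) : ℝ) • ∫ t : ℝ, LSeries.term f ((2 : ℝ) + t * I) n * k t := by
    intro n
    rcases eq_or_ne n 0 with rfl | hn
    · simp
    · have h := exp_neg_mul_eq_integral hz two_pos (x := n) (by exact_mod_cast hn.bot_lt)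
      rw [ofReal_natCast] at h
      rw [h, mul_smul_comm, ← MeasureTheory.integral_const_mul]
      congr 2
      funext t
      rw [LSeries.term_of_ne_zero hn, cpow_neg, ← mul_assoc, ← div_eq_mul_inv]
  simp only [hterm]
  exact hsum'

lemma exp_neg_div_eq_integral {z : ℂ} (hz : 0 < z.re) :
    cexp (-z) / z = (1 / (2 * Real.pi) : ℝ) • ∫ t : ℝ,
        1 / ((2 : ℝ) + t * I - 1) * gammaKernel z ((2 : ℝ) + t * I) := by
  have h := exp_neg_mul_eq_integral hz one_pos one_pos
  simp only [ofReal_one, mul_one, one_cpow, one_mul] at h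
  rw [h, div_eq_mul_one_div, smul_mul_assoc, ← MeasureTheory.integral_mul_const]
  congr 2
  funext t
  have hz0 := ne_zero_of_re_pos hz
  have h1 : (1 : ℂ) + t * I ≠ 0 := fun h ↦ by
    have := congrArg re h
    simp at this
  have h2 : ((2 : ℝ) : ℂ) + t * I = 1 + t * I + 1 := by push_cast; ring
  rw [gammaKernel, gammaKernel, h2, Gamma_add_one _ h1,
    cpow_add (1 + t * I) 1 (one_div_ne_zero hz0),
    cpow_one, add_sub_cancel_right]
  field_simp

lemma differentiableAt_logDeriv_zetaReg (hRH : RiemannHypothesis) {s : ℂ} (hs : 1 / 2 < s.re) :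
    DifferentiableAt ℂ (logDeriv zetaReg) s :=
  (differentiable_zetaReg.deriv s).div (differentiable_zetaReg s) (zetaReg_ne_zero hRH hs)

lemma logDeriv_zetaReg_conj (s : ℂ) :
    logDeriv zetaReg (starRingEnd ℂ s) = starRingEnd ℂ (logDeriv zetaReg s) := by
  have h : starRingEnd ℂ ∘ zetaReg ∘ starRingEnd ℂ = zetaReg := by
    funext s
    simp [zetaReg_conj]
  have h2 := congrFun (deriv_conj_conj (f := zetaReg)) (starRingEnd ℂ s)
  simp only [h, Function.comp_apply, conj_conj] at h2
  rw [logDeriv_apply, logDeriv_apply, h2, zetaReg_conj, map_div₀]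

lemma exists_norm_logDeriv_zetaReg_mul_gammaKernel_le (hRH : RiemannHypothesis) {z : ℂ}
    (hz : 0 < z.re) {a b c : ℝ} (ha : 0 < a) (hc : 1 / 2 < c) :
    ∃ B : ℝ, ∀ τ ∈ Icc c 3, ∀ σ ∈ Icc a b, ∀ t u : ℝ, |u| = |t| →
      ‖logDeriv zetaReg (τ + u * I) * gammaKernel z (σ + t * I)‖ ≤ B / (1 + t ^ 2) := by
  obtain ⟨K, hK, hKb⟩ := exists_norm_logDeriv_zetaReg_le hRH
  obtain ⟨D, hD, hDb⟩ := exists_log_mul_norm_gammaKernel_le hz ha b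
  have hc0 : 0 < c - 1 / 2 := by linarith
  refine ⟨K * (1 + 1 / (c - 1 / 2)) * D, fun τ hτ σ hσ t u hu ↦ ?_⟩
  have h1 := hKb τ u (hc.trans_le hτ.1) hτ.2
  have h2 : 1 + 1 / (τ - 1 / 2) ≤ 1 + 1 / (c - 1 / 2) := by
    gcongr
    exact hτ.1
  have hlog : 0 ≤ Real.log (|t| + 4) := zero_le_one.trans (one_le_log_abs_add_four t)
  rw [hu] at h1
  rw [norm_mul]
  calc _ ≤ K * Real.log (|t| + 4) * (1 + 1 / (c - 1 / 2)) * ‖gammaKernel z (σ + t * I)‖ := by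
        gcongr
        exact h1.trans (by gcongr)
    _ = K * (1 + 1 / (c - 1 / 2)) * (Real.log (|t| + 4) * ‖gammaKernel z (σ + t * I)‖) := by ring
    _ ≤ K * (1 + 1 / (c - 1 / 2)) * (D / (1 + t ^ 2)) := by
        gcongr
        exact hDb σ hσ t
    _ = _ := by ring

lemma integral_logDeriv_zetaReg_mul_gammaKernel_eq (hRH : RiemannHypothesis) {z : ℂ}
    (hz : 0 < z.re) {c : ℝ} (hc : 1 / 2 < c) (hc2 : c ≤ 2) :
    ∫ t : ℝ, logDeriv zetaReg (c + t * I) * gammaKernel z (c + t * I) =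
      ∫ t : ℝ, logDeriv zetaReg ((2 : ℝ) + t * I) * gammaKernel z ((2 : ℝ) + t * I) := by
  obtain ⟨B, hB⟩ := exists_norm_logDeriv_zetaReg_mul_gammaKernel_le hRH hz (a := c) (b := 2)
    (by linarith) hc
  refine integral_vertical_eq (f := fun s ↦ logDeriv zetaReg s * gammaKernel z s) hc2 ?_
    fun σ hσ t ↦ hB σ ⟨hσ.1, by linarith [hσ.2]⟩ σ hσ t t rfl
  intro s hs
  have hs' : c ≤ s.re := hs.1
  exact ((differentiableAt_logDeriv_zetaReg hRH (by linarith)).mul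
    (differentiableAt_gammaKernel hz (by linarith))).differentiableWithinAt

/-- The conjugate of `ζ'/ζ` on a vertical line `re s = c` agrees with the holomorphic function
`ζ'/ζ (2 c - s)`, which allows one to move the line to the left. -/
lemma integral_conj_logDeriv_zetaReg_mul_gammaKernel_eq (hRH : RiemannHypothesis) {z : ℂ}
    (hz : 0 < z.re) {c : ℝ} (hc : 1 / 2 < c) (hc2 : c ≤ 1) :
    ∫ t : ℝ, starRingEnd ℂ (logDeriv zetaReg (c + t * I)) * gammaKernel z (c + t * I) =
      ∫ t : ℝ, logDeriv zetaReg ((2 * c - 1 / 4 : ℝ) + (-t : ℝ) * I) *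
        gammaKernel z ((1 / 4 : ℝ) + t * I) := by
  obtain ⟨B, hB⟩ := exists_norm_logDeriv_zetaReg_mul_gammaKernel_le hRH hz (a := 1 / 4) (b := c)
    (by norm_num) hc
  have hrefl : ∀ σ t : ℝ, (2 * c - (σ + t * I) : ℂ) = (2 * c - σ : ℝ) + (-t : ℝ) * I := by
    intro σ t
    push_cast
    ring
  have h := integral_vertical_eq (f := fun s ↦ logDeriv zetaReg (2 * c - s) * gammaKernel z s)
    (a := 1 / 4) (b := c) (B := B) (by linarith) ?_ ?_
  · simp only [hrefl] at h
    rw [h]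
    congr 1
    funext t
    rw [← logDeriv_zetaReg_conj]
    congr 2
    simp
    ring
  · intro s hs
    have hs1 : 1 / 4 ≤ s.re := hs.1
    have hs2 : s.re ≤ c := hs.2
    have h1 : DifferentiableAt ℂ (logDeriv zetaReg) (2 * c - s) :=
      differentiableAt_logDeriv_zetaReg hRH (by simp; linarith)
    refine (DifferentiableAt.mul ?_
      (differentiableAt_gammaKernel hz (by linarith))).differentiableWithinAt
    exact h1.comp (f := fun s ↦ 2 * (c : ℂ) - s) s (by fun_prop)
  · intro σ hσ t
    simp only [hrefl]
    exact hB _ ⟨by linarith [hσ.2], by linarith [hσ.1]⟩ σ hσ t (-t) (abs_neg t)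

lemma tsum_vonMangoldt_sub_eq {z : ℂ} (hRH : RiemannHypothesis) (hz : 0 < z.re) :
    ∑' n : ℕ, (ArithmeticFunction.vonMangoldt n : ℂ) * cexp (-(z * n)) - cexp (-z) / z =
      -((1 / (2 * Real.pi) : ℝ) • ∫ t : ℝ,
        logDeriv zetaReg ((2 : ℝ) + t * I) * gammaKernel z ((2 : ℝ) + t * I)) := by
  have hk := integrable_gammaKernel hz two_pos
  obtain ⟨B, hB⟩ := exists_norm_logDeriv_zetaReg_mul_gammaKernel_le hRH hz (a := 2) (b := 2)
    (c := 2) two_pos (by norm_num)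
  have hcont : Continuous fun t : ℝ ↦ logDeriv zetaReg ((2 : ℝ) + t * I) :=
    continuous_logDeriv_zetaReg_line hRH (by norm_num)
  have hGK : MeasureTheory.Integrable fun t : ℝ ↦
      logDeriv zetaReg ((2 : ℝ) + t * I) * gammaKernel z ((2 : ℝ) + t * I) :=
    (integrable_div_one_add_sq B).mono'
      (hcont.aestronglyMeasurable.mul hk.aestronglyMeasurable) (Eventually.of_forall fun t ↦
        hB 2 ⟨le_rfl, by norm_num⟩ 2 ⟨le_rfl, le_rfl⟩ t t rfl)
  have hone : MeasureTheory.Integrable fun t : ℝ ↦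
      1 / (((2 : ℝ) : ℂ) + t * I - 1) * gammaKernel z ((2 : ℝ) + t * I) := by
    have hre : ∀ t : ℝ, (((2 : ℝ) : ℂ) + t * I - 1).re = 1 := fun t ↦ by
      simp
      norm_num
    refine hk.bdd_mul (c := 1) (Continuous.aestronglyMeasurable ?_)
      (Eventually.of_forall fun t ↦ ?_)
    · refine continuous_const.div (by fun_prop) fun t h ↦ ?_
      have := hre t
      rw [h] at this
      simp at this
    · rw [norm_div, norm_one]
      refine div_le_one_of_le₀ ?_ (norm_nonneg _)
      refine le_trans ?_ (abs_re_le_norm _)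
      rw [hre, abs_one]
  rw [(hasSum_vonMangoldt_mul_exp hz).tsum_eq, exp_neg_div_eq_integral hz, ← smul_sub, ← smul_neg]
  congr 1
  have hL : ∀ t : ℝ, LSeries (fun n ↦ (ArithmeticFunction.vonMangoldt n : ℂ)) ((2 : ℝ) + t * I) *
      gammaKernel z ((2 : ℝ) + t * I) =
      1 / (((2 : ℝ) : ℂ) + t * I - 1) * gammaKernel z ((2 : ℝ) + t * I) -
        logDeriv zetaReg ((2 : ℝ) + t * I) * gammaKernel z ((2 : ℝ) + t * I) := by
    intro t
    rw [logDeriv_zetaReg_eq (by simp)]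
    ring
  simp only [hL]
  rw [MeasureTheory.integral_sub hone hGK]
  ring

lemma norm_tsum_vonMangoldt_sub_le {z : ℂ} (hRH : RiemannHypothesis) (hz : 0 < z.re) {c : ℝ}
    (hc : 1 / 2 < c) (hc1 : c ≤ 1) :
    ‖∑' n : ℕ, (ArithmeticFunction.vonMangoldt n : ℂ) * cexp (-(z * n)) - cexp (-z) / z‖ ≤
      (∫ t : ℝ, |(logDeriv zetaReg (c + t * I)).re| * ‖gammaKernel z (c + t * I)‖) +
        ∫ t : ℝ, ‖logDeriv zetaReg ((2 * c - 1 / 4 : ℝ) + (-t : ℝ) * I)‖ *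
          ‖gammaKernel z ((1 / 4 : ℝ) + t * I)‖ := by
  have hk := integrable_gammaKernel hz (σ := c) (by linarith)
  have hcont := continuous_logDeriv_zetaReg_line hRH hc
  obtain ⟨B, hB⟩ := exists_norm_logDeriv_zetaReg_mul_gammaKernel_le hRH hz (a := c) (b := c)
    (c := c) (by linarith) hc
  have hb := fun t : ℝ ↦ hB c ⟨le_rfl, by linarith⟩ c ⟨le_rfl, le_rfl⟩ t t rfl
  have hconj : MeasureTheory.Integrable fun t : ℝ ↦
      starRingEnd ℂ (logDeriv zetaReg (c + t * I)) * gammaKernel z (c + t * I) := by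
    refine (integrable_div_one_add_sq B).mono'
      ((continuous_conj.comp hcont).aestronglyMeasurable.mul hk.aestronglyMeasurable)
      (Eventually.of_forall fun t ↦ ?_)
    simpa [norm_mul] using hb t
  have hre : MeasureTheory.Integrable fun t : ℝ ↦
      ((2 * (logDeriv zetaReg (c + t * I)).re : ℝ) : ℂ) * gammaKernel z (c + t * I) := by
    refine ((integrable_div_one_add_sq B).const_mul 2).mono'
      ((continuous_ofReal.comp (continuous_const.mul
        (continuous_re.comp hcont))).aestronglyMeasurable.mul hk.aestronglyMeasurable)
      (Eventually.of_forall fun t ↦ ?_)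
    rw [norm_mul, norm_real, norm_mul, Real.norm_two, mul_assoc]
    refine mul_le_mul_of_nonneg_left (le_trans ?_ (hb t)) two_pos.le
    rw [norm_mul]
    gcongr
    exact abs_re_le_norm _
  have hsplit : ∀ t : ℝ, logDeriv zetaReg (c + t * I) * gammaKernel z (c + t * I) =
      ((2 * (logDeriv zetaReg (c + t * I)).re : ℝ) : ℂ) * gammaKernel z (c + t * I) -
        starRingEnd ℂ (logDeriv zetaReg (c + t * I)) * gammaKernel z (c + t * I) := by
    intro t
    rw [← add_conj]
    ring
  rw [tsum_vonMangoldt_sub_eq hRH hz,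
    ← integral_logDeriv_zetaReg_mul_gammaKernel_eq hRH hz hc (by linarith)]
  simp only [hsplit]
  rw [MeasureTheory.integral_sub hre hconj,
    integral_conj_logDeriv_zetaReg_mul_gammaKernel_eq hRH hz hc hc1, norm_neg, norm_smul,
    Real.norm_of_nonneg (by positivity)]
  have h1 : ‖∫ t : ℝ, ((2 * (logDeriv zetaReg (c + t * I)).re : ℝ) : ℂ) *
      gammaKernel z (c + t * I)‖ ≤
      2 * ∫ t : ℝ, |(logDeriv zetaReg (c + t * I)).re| * ‖gammaKernel z (c + t * I)‖ := by
    refine (MeasureTheory.norm_integral_le_integral_norm _).trans (le_of_eq ?_)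
    rw [← MeasureTheory.integral_const_mul]
    congr 1
    funext t
    rw [norm_mul, norm_real, norm_mul, Real.norm_two, mul_assoc, Real.norm_eq_abs]
  have h2 : ‖∫ t : ℝ, logDeriv zetaReg ((2 * c - 1 / 4 : ℝ) + (-t : ℝ) * I) *
      gammaKernel z ((1 / 4 : ℝ) + t * I)‖ ≤
      ∫ t : ℝ, ‖logDeriv zetaReg ((2 * c - 1 / 4 : ℝ) + (-t : ℝ) * I)‖ *
          ‖gammaKernel z ((1 / 4 : ℝ) + t * I)‖ := by
    refine (MeasureTheory.norm_integral_le_integral_norm _).trans (le_of_eq ?_)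
    simp only [norm_mul]
  have h3 : 0 ≤ ∫ t : ℝ, |(logDeriv zetaReg (c + t * I)).re| * ‖gammaKernel z (c + t * I)‖ :=
    MeasureTheory.integral_nonneg fun t ↦ by positivity
  have h4 : 0 ≤ ∫ t : ℝ, ‖logDeriv zetaReg ((2 * c - 1 / 4 : ℝ) + (-t : ℝ) * I)‖ *
      ‖gammaKernel z ((1 / 4 : ℝ) + t * I)‖ :=
    MeasureTheory.integral_nonneg fun t ↦ by positivity
  have hpi : 1 / (2 * Real.pi) ≤ 1 / 2 := by
    refine one_div_le_one_div_of_le two_pos ?_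
    linarith [Real.pi_gt_three]
  calc _ ≤ 1 / 2 * (2 * (∫ t : ℝ, |(logDeriv zetaReg (c + t * I)).re| *
        ‖gammaKernel z (c + t * I)‖) + ∫ t : ℝ, ‖logDeriv zetaReg ((2 * c - 1 / 4 : ℝ) +
          (-t : ℝ) * I)‖ * ‖gammaKernel z ((1 / 4 : ℝ) + t * I)‖) :=
        mul_le_mul hpi ((norm_sub_le _ _).trans (add_le_add h1 h2)) (norm_nonneg _) (by norm_num)
    _ ≤ _ := by linarith

lemma integral_exp_neg_mul_abs {b : ℝ} (hb : 0 < b) :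
    ∫ t : ℝ, Real.exp (-(b * |t|)) = 2 / b := by
  rw [integral_comp_abs (f := fun t ↦ Real.exp (-(b * t)))]
  have h := integral_exp_mul_Ioi (a := -b) (by linarith) 0
  simp only [neg_mul, mul_zero, Real.exp_zero] at h
  rw [h]
  field_simp

lemma integrable_exp_neg_mul_abs {b : ℝ} (hb : 0 < b) :
    MeasureTheory.Integrable fun t : ℝ ↦ Real.exp (-(b * |t|)) :=
  MeasureTheory.Integrable.of_integral_ne_zero (by rw [integral_exp_neg_mul_abs hb]; positivity)

lemma log_mul_exp_neg_mul_abs_le {a : ℝ} (ha : 0 < a) (ha1 : a ≤ 1) (t : ℝ) :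
    Real.log (|t| + 4) * Real.exp (-(a * |t|)) ≤
      2 * Real.log (4 / a) * Real.exp (-(a / 2 * |t|)) := by
  have h4 : (4 : ℝ) ≤ 4 / a := by
    rw [le_div_iff₀ ha]
    linarith
  have h1 : 1 ≤ Real.log (4 / a) := by
    refine (one_le_log_abs_add_four 0).trans ?_
    rw [abs_zero, zero_add]
    exact Real.log_le_log (by norm_num) h4
  have h0 : 0 ≤ a * |t| := by positivity
  have h2 : |t| + 4 ≤ 4 / a * Real.exp (a * |t| / 4) := by
    have h3 := Real.add_one_le_exp (a * |t| / 4)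
    calc |t| + 4 ≤ |t| + 4 / a := by linarith
      _ = 4 / a * (a * |t| / 4 + 1) := by field_simp
      _ ≤ _ := by gcongr
  have h5 : Real.log (|t| + 4) ≤ Real.log (4 / a) + a * |t| / 4 := by
    refine (Real.log_le_log (by positivity) h2).trans (le_of_eq ?_)
    rw [Real.log_mul (by positivity) (Real.exp_pos _).ne', Real.log_exp]
  have h6 : Real.exp (-(a / 2 * |t|)) = Real.exp (a / 2 * |t|) * Real.exp (-(a * |t|)) := by
    rw [← Real.exp_add]
    congr 1
    ring
  rw [h6, ← mul_assoc]
  gcongr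
  have h7 := Real.add_one_le_exp (a / 2 * |t|)
  nlinarith

lemma integrable_log_mul_exp_neg_mul_abs {a : ℝ} (ha : 0 < a) (ha1 : a ≤ 1) :
    MeasureTheory.Integrable fun t : ℝ ↦ Real.log (|t| + 4) * Real.exp (-(a * |t|)) := by
  refine ((integrable_exp_neg_mul_abs (half_pos ha)).const_mul (2 * Real.log (4 / a))).mono'
    (Measurable.aestronglyMeasurable (by fun_prop)) (Eventually.of_forall fun t ↦ ?_)
  have := one_le_log_abs_add_four t
  rw [Real.norm_of_nonneg (by positivity)]
  exact log_mul_exp_neg_mul_abs_le ha ha1 t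

lemma integral_log_mul_exp_neg_mul_abs_le {a : ℝ} (ha : 0 < a) (ha1 : a ≤ 1) :
    ∫ t : ℝ, Real.log (|t| + 4) * Real.exp (-(a * |t|)) ≤ 8 * Real.log (4 / a) / a := by
  refine (MeasureTheory.integral_mono (integrable_log_mul_exp_neg_mul_abs ha ha1)
    ((integrable_exp_neg_mul_abs (half_pos ha)).const_mul (2 * Real.log (4 / a)))
    (log_mul_exp_neg_mul_abs_le ha ha1)).trans (le_of_eq ?_)
  rw [MeasureTheory.integral_const_mul, integral_exp_neg_mul_abs (half_pos ha)]
  field_simp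
  ring

/-- A function with controlled mean values on unit intervals, integrated against an exponential. -/
lemma lintegral_mul_exp_neg_mul_abs_le {u L : ℝ → ℝ} {a : ℝ} (ha : 0 ≤ a) (hu : Continuous u)
    (hu0 : ∀ t, 0 ≤ u t) (huL : ∀ T, ∫ t in (T - 1 / 2)..(T + 1 / 2), u t ≤ L T) :
    ∫⁻ t : ℝ, ENNReal.ofReal (u t * Real.exp (-(a * |t|))) ≤
      ∫⁻ T : ℝ, ENNReal.ofReal (Real.exp (a / 2) * (L T * Real.exp (-(a * |T|)))) := by
  set w : ℝ → ENNReal := fun t ↦ ENNReal.ofReal (u t * Real.exp (-(a * |t|))) with hw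
  have hwm : Measurable w := by fun_prop
  have h1 : ∫⁻ t, w t = ∫⁻ s in Ioc (-(1 / 2) : ℝ) (1 / 2), ∫⁻ T, w (T + s) := by
    simp only [MeasureTheory.lintegral_add_right_eq_self]
    rw [MeasureTheory.lintegral_const, MeasureTheory.Measure.restrict_apply_univ, Real.volume_Ioc]
    norm_num
  rw [h1, MeasureTheory.lintegral_lintegral_swap (f := fun s T : ℝ ↦ w (T + s))
    (hwm.comp (measurable_snd.add measurable_fst)).aemeasurable]
  refine MeasureTheory.lintegral_mono fun T ↦ ?_
  have hcont : Continuous fun s ↦ u (T + s) := by fun_prop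
  have h2 : ∫⁻ s in Ioc (-(1 / 2) : ℝ) (1 / 2), ENNReal.ofReal (u (T + s)) ≤
      ENNReal.ofReal (L T) := by
    rw [← MeasureTheory.ofReal_integral_eq_lintegral_ofReal
      (hcont.integrableOn_Ioc) (Eventually.of_forall fun s ↦ hu0 _)]
    refine ENNReal.ofReal_le_ofReal ?_
    rw [← intervalIntegral.integral_of_le (by norm_num), intervalIntegral.integral_comp_add_left]
    exact huL T
  calc ∫⁻ s in Ioc (-(1 / 2) : ℝ) (1 / 2), w (T + s)
      ≤ ∫⁻ s in Ioc (-(1 / 2) : ℝ) (1 / 2), ENNReal.ofReal (u (T + s)) *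
          ENNReal.ofReal (Real.exp (a / 2) * Real.exp (-(a * |T|))) := by
        refine MeasureTheory.lintegral_mono_ae ?_
        filter_upwards [MeasureTheory.ae_restrict_mem measurableSet_Ioc] with s hs
        rw [hw, ← ENNReal.ofReal_mul (hu0 _)]
        refine ENNReal.ofReal_le_ofReal (mul_le_mul_of_nonneg_left ?_ (hu0 _))
        rw [← Real.exp_add, Real.exp_le_exp]
        have h3 : |s| ≤ 1 / 2 := abs_le.mpr ⟨hs.1.le, hs.2⟩
        have h4 : |T| ≤ |T + s| + |s| := by
          have := abs_sub (T + s) s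
          rwa [add_sub_cancel_right] at this
        nlinarith
    _ ≤ ENNReal.ofReal (L T) * ENNReal.ofReal (Real.exp (a / 2) * Real.exp (-(a * |T|))) := by
        rw [MeasureTheory.lintegral_mul_const' _ _ ENNReal.ofReal_ne_top]
        gcongr
    _ = _ := by
        rw [← ENNReal.ofReal_mul' (by positivity)]
        congr 1
        ring

lemma integral_mul_exp_neg_mul_abs_le {u L : ℝ → ℝ} {a : ℝ} (ha : 0 ≤ a) (hu : Continuous u)
    (hu0 : ∀ t, 0 ≤ u t) (huL : ∀ T, ∫ t in (T - 1 / 2)..(T + 1 / 2), u t ≤ L T)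
    (hL : MeasureTheory.Integrable fun T ↦ L T * Real.exp (-(a * |T|))) :
    (MeasureTheory.Integrable fun t ↦ u t * Real.exp (-(a * |t|))) ∧
      ∫ t, u t * Real.exp (-(a * |t|)) ≤ Real.exp (a / 2) * ∫ T, L T * Real.exp (-(a * |T|)) := by
  have hL0 : ∀ T, 0 ≤ L T := fun T ↦
    (intervalIntegral.integral_nonneg (by linarith) fun t _ ↦ hu0 t).trans (huL T)
  have h0 : ∀ t, 0 ≤ u t * Real.exp (-(a * |t|)) := fun t ↦ mul_nonneg (hu0 t) (Real.exp_pos _).le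
  have hmeas : MeasureTheory.AEStronglyMeasurable (fun t ↦ u t * Real.exp (-(a * |t|)))
      MeasureTheory.volume := Continuous.aestronglyMeasurable (by fun_prop)
  have h := lintegral_mul_exp_neg_mul_abs_le ha hu hu0 huL
  rw [← MeasureTheory.ofReal_integral_eq_lintegral_ofReal (hL.const_mul _)
    (Eventually.of_forall fun T ↦ by have := hL0 T; positivity),
    MeasureTheory.integral_const_mul] at h
  refine ⟨⟨hmeas, ?_⟩, ?_⟩
  · rw [MeasureTheory.hasFiniteIntegral_iff_ofReal (Eventually.of_forall h0)]
    exact h.trans_lt ENNReal.ofReal_lt_top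
  · rw [MeasureTheory.integral_eq_lintegral_of_nonneg_ae (Eventually.of_forall h0) hmeas]
    refine ENNReal.toReal_le_of_le_ofReal ?_ h
    exact mul_nonneg (Real.exp_pos _).le (MeasureTheory.integral_nonneg fun T ↦
      mul_nonneg (hL0 T) (Real.exp_pos _).le)

lemma re_div_norm_le_pi_div_two_sub_abs_arg {z : ℂ} (hz : 0 < z.re) :
    z.re / ‖z‖ ≤ Real.pi / 2 - |z.arg| := by
  have harg : |z.arg| < Real.pi / 2 := abs_arg_lt_pi_div_two_iff.mpr (Or.inl hz)
  have h := norm_mul_cos_arg z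
  have hz0 : 0 < ‖z‖ := norm_pos_iff.mpr (ne_zero_of_re_pos hz)
  rw [← h, mul_div_cancel_left₀ _ hz0.ne', ← Real.cos_abs, ← Real.sin_pi_div_two_sub]
  exact Real.sin_le (by linarith)

lemma norm_gammaKernel_half_add_le {z : ℂ} (hz : 0 < z.re) {δ : ℝ} (hδ : 0 ≤ δ) (hδ1 : δ ≤ 1)
    (t : ℝ) :
    ‖gammaKernel z ((1 / 2 + δ : ℝ) + t * I)‖ ≤
      6 * ‖z‖ ^ (-(1 / 2) : ℝ) * (2 / z.re) ^ δ * Real.exp (-(z.re / (2 * ‖z‖) * |t|)) := by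
  have hη := re_div_norm_le_pi_div_two_sub_abs_arg hz
  have hz0 : 0 < ‖z‖ := norm_pos_iff.mpr (ne_zero_of_re_pos hz)
  set b := z.re / (2 * ‖z‖) with hb
  have hb0 : 0 < b := by positivity
  have hb2 : z.re / ‖z‖ = 2 * b := by
    rw [hb]
    field_simp
  have hb1 : b ≤ 1 / 2 := by
    rw [hb, div_le_iff₀ (by positivity)]
    linarith [(le_abs_self _).trans (abs_re_le_norm z)]
  have hpi := Real.pi_gt_three
  have key : ‖Gamma ((1 / 2 + δ : ℝ) + t * I)‖ * Real.exp ((Real.pi / 2 - b) * |t|) ≤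
      6 * (1 / b) ^ δ := by
    rcases abs_choice t with h | h
    · have h1 := norm_Gamma_half_add_mul_exp_le (φ := Real.pi / 2 - b) t
        (by rw [abs_of_pos (by linarith)]; linarith) hδ hδ1
      rw [abs_of_pos (a := Real.pi / 2 - b) (by linarith), sub_sub_cancel] at h1
      rwa [h]
    · have h1 := norm_Gamma_half_add_mul_exp_le (φ := -(Real.pi / 2 - b)) t
        (by rw [abs_neg, abs_of_pos (by linarith)]; linarith) hδ hδ1
      rw [abs_neg, abs_of_pos (a := Real.pi / 2 - b) (by linarith), sub_sub_cancel] at h1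
      rw [h]
      rwa [neg_mul, ← mul_neg] at h1
  refine (norm_gammaKernel_le hz key).trans ?_
  have h2 : ‖z‖ ^ (-(1 / 2 + δ)) * (6 * (1 / b) ^ δ) =
      6 * ‖z‖ ^ (-(1 / 2) : ℝ) * (2 / z.re) ^ δ := by
    have h3 : 2 / z.re = (1 / b) / ‖z‖ := by
      rw [hb]
      field_simp
    rw [h3, Real.div_rpow (by positivity) hz0.le, neg_add, Real.rpow_add hz0,
      Real.rpow_neg hz0.le δ]
    field_simp
  rw [h2]
  gcongr
  linarith

lemma exists_norm_gammaKernel_quarter_le : ∃ C > 0, ∀ z : ℂ, 0 < z.re → ‖z‖ ≤ 4 → ∀ t : ℝ,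
    ‖gammaKernel z ((1 / 4 : ℝ) + t * I)‖ ≤
      C * ‖z‖ ^ (-(1 / 2) : ℝ) * Real.exp (-(z.re / (2 * ‖z‖) * |t|)) := by
  obtain ⟨C, hC, hCb⟩ := exists_norm_Gamma_quarter_mul_exp_le
  refine ⟨4 * C, by positivity, fun z hz hz4 t ↦ ?_⟩
  have hη := re_div_norm_le_pi_div_two_sub_abs_arg hz
  have hz0 : 0 < ‖z‖ := norm_pos_iff.mpr (ne_zero_of_re_pos hz)
  have h1 := norm_gammaKernel_le hz (σ := 1 / 4) (t := t) (φ := Real.pi / 2) (C := C)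
    (by simpa using hCb t)
  refine h1.trans ?_
  have h2 : ‖z‖ ^ (-(1 / 4) : ℝ) ≤ 4 * ‖z‖ ^ (-(1 / 2) : ℝ) := by
    have h3 : ‖z‖ ^ (-(1 / 4) : ℝ) = ‖z‖ ^ (1 / 4 : ℝ) * ‖z‖ ^ (-(1 / 2) : ℝ) := by
      rw [← Real.rpow_add hz0]
      norm_num
    rw [h3]
    gcongr
    calc ‖z‖ ^ (1 / 4 : ℝ) ≤ (4 : ℝ) ^ (1 / 4 : ℝ) := by gcongr
      _ ≤ (4 : ℝ) ^ (1 : ℝ) := Real.rpow_le_rpow_of_exponent_le (by norm_num) (by norm_num)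
      _ = 4 := Real.rpow_one 4
  have h4 : z.re / (2 * ‖z‖) ≤ Real.pi / 2 - |z.arg| := by
    refine le_trans ?_ hη
    gcongr
    linarith
  calc _ ≤ 4 * ‖z‖ ^ (-(1 / 2) : ℝ) * C * Real.exp (-(z.re / (2 * ‖z‖) * |t|)) := by gcongr
    _ = _ := by ring

lemma norm_exp_neg_div_sub_one_div_le {z : ℂ} (hz : 0 < z.re) :
    ‖cexp (-z) / z - 1 / z‖ ≤ 2 := by
  have hz0 : 0 < ‖z‖ := norm_pos_iff.mpr (ne_zero_of_re_pos hz)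
  rw [← sub_div, norm_div, div_le_iff₀ hz0]
  rcases le_total ‖z‖ 1 with h | h
  · simpa using norm_exp_sub_one_le (x := -z) (by simpa using h)
  · have h1 : ‖cexp (-z)‖ ≤ 1 := by
      rw [norm_exp, Real.exp_le_one_iff]
      simpa using hz.le
    have h2 := norm_sub_le (cexp (-z)) 1
    rw [norm_one] at h2
    linarith

lemma exists_integral_abs_re_logDeriv_mul_gammaKernel_le (hRH : RiemannHypothesis) :
    ∃ K > 0, ∀ z : ℂ, 0 < z.re → ∀ δ : ℝ, 0 < δ → δ ≤ 1 →
      ∫ t : ℝ, |(logDeriv zetaReg ((1 / 2 + δ : ℝ) + t * I)).re| *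
        ‖gammaKernel z ((1 / 2 + δ : ℝ) + t * I)‖ ≤
      K * ‖z‖ ^ (-(1 / 2) : ℝ) * (2 / z.re) ^ δ *
        ((2 * ‖z‖ / z.re) * Real.log (8 * ‖z‖ / z.re)) := by
  obtain ⟨K, hK, hKb⟩ := exists_integral_abs_re_logDeriv_zetaReg_le hRH
  refine ⟨6 * Real.exp 1 * K * 8, by positivity, fun z hz δ hδ hδ1 ↦ ?_⟩
  have hz0 : 0 < ‖z‖ := norm_pos_iff.mpr (ne_zero_of_re_pos hz)
  have hb0 : 0 < z.re / (2 * ‖z‖) := by positivity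
  have hb1 : z.re / (2 * ‖z‖) ≤ 1 := by
    rw [div_le_iff₀ (by positivity)]
    linarith [(le_abs_self _).trans (abs_re_le_norm z)]
  have hL := (integrable_log_mul_exp_neg_mul_abs hb0 hb1).const_mul K
  simp only [← mul_assoc] at hL
  have hJ := integral_log_mul_exp_neg_mul_abs_le hb0 hb1
  set b := z.re / (2 * ‖z‖) with hb
  obtain ⟨hint, hle⟩ := integral_mul_exp_neg_mul_abs_le hb0.le
    (continuous_re.comp (continuous_logDeriv_zetaReg_line hRH (σ := 1 / 2 + δ) (by linarith))).abs
    (fun t ↦ abs_nonneg _) (fun T ↦ hKb (1 / 2 + δ) T (by linarith) (by linarith)) hL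
  set A := 6 * ‖z‖ ^ (-(1 / 2) : ℝ) * (2 / z.re) ^ δ with hA
  have hA0 : 0 ≤ A := by positivity
  calc _ ≤ ∫ t : ℝ, A * (|(logDeriv zetaReg ((1 / 2 + δ : ℝ) + t * I)).re| *
        Real.exp (-(b * |t|))) := by
        refine MeasureTheory.integral_mono_of_nonneg (Eventually.of_forall fun t ↦ by positivity)
          (hint.const_mul A) (Eventually.of_forall fun t ↦ ?_)
        calc _ ≤ |(logDeriv zetaReg ((1 / 2 + δ : ℝ) + t * I)).re| *
              (A * Real.exp (-(b * |t|))) :=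
              mul_le_mul_of_nonneg_left (norm_gammaKernel_half_add_le hz hδ.le hδ1 t)
                (abs_nonneg _)
          _ = _ := by ring
    _ ≤ A * (Real.exp 1 * (K * (8 * Real.log (4 / b) / b))) := by
        rw [MeasureTheory.integral_const_mul]
        refine mul_le_mul_of_nonneg_left (hle.trans ?_) hA0
        simp only [mul_assoc K, MeasureTheory.integral_const_mul]
        have h0 : 0 ≤ ∫ t : ℝ, Real.log (|t| + 4) * Real.exp (-(b * |t|)) :=
          MeasureTheory.integral_nonneg fun t ↦ mul_nonneg
            (zero_le_one.trans (one_le_log_abs_add_four t)) (Real.exp_pos _).le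
        gcongr
        linarith
    _ = _ := by
        have h4 : 4 / b = 8 * ‖z‖ / z.re := by
          rw [hb]
          field_simp
          norm_num
        rw [h4, hA, hb]
        field_simp

lemma exists_integral_norm_logDeriv_mul_gammaKernel_le (hRH : RiemannHypothesis) :
    ∃ K > 0, ∀ z : ℂ, 0 < z.re → ‖z‖ ≤ 4 → ∀ τ : ℝ, 3 / 4 ≤ τ → τ ≤ 3 →
      ∫ t : ℝ, ‖logDeriv zetaReg (τ + (-t : ℝ) * I)‖ *
        ‖gammaKernel z ((1 / 4 : ℝ) + t * I)‖ ≤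
      K * ‖z‖ ^ (-(1 / 2) : ℝ) * ((2 * ‖z‖ / z.re) * Real.log (8 * ‖z‖ / z.re)) := by
  obtain ⟨K, hK, hKb⟩ := exists_norm_logDeriv_zetaReg_le hRH
  obtain ⟨C, hC, hCb⟩ := exists_norm_gammaKernel_quarter_le
  refine ⟨5 * K * C * 8, by positivity, fun z hz hz4 τ hτ hτ3 ↦ ?_⟩
  have hz0 : 0 < ‖z‖ := norm_pos_iff.mpr (ne_zero_of_re_pos hz)
  have hb0 : 0 < z.re / (2 * ‖z‖) := by positivity
  have hb1 : z.re / (2 * ‖z‖) ≤ 1 := by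
    rw [div_le_iff₀ (by positivity)]
    linarith [(le_abs_self _).trans (abs_re_le_norm z)]
  have hL := integrable_log_mul_exp_neg_mul_abs hb0 hb1
  have hJ := integral_log_mul_exp_neg_mul_abs_le hb0 hb1
  have hker := hCb z hz hz4
  set b := z.re / (2 * ‖z‖) with hb
  set A := 5 * K * (C * ‖z‖ ^ (-(1 / 2) : ℝ)) with hA
  have hA0 : 0 ≤ A := by positivity
  calc _ ≤ ∫ t : ℝ, A * (Real.log (|t| + 4) * Real.exp (-(b * |t|))) := by
        refine MeasureTheory.integral_mono_of_nonneg (Eventually.of_forall fun t ↦ by positivity)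
          (hL.const_mul A) (Eventually.of_forall fun t ↦ ?_)
        have h1 := hKb τ (-t) (by linarith) hτ3
        rw [abs_neg] at h1
        have h2 : 1 / (τ - 1 / 2) ≤ 4 := by
          rw [div_le_iff₀ (by linarith)]
          linarith
        have h3 := one_le_log_abs_add_four t
        calc _ ≤ (K * Real.log (|t| + 4) * (1 + 4)) *
              (C * ‖z‖ ^ (-(1 / 2) : ℝ) * Real.exp (-(b * |t|))) := by
              refine mul_le_mul (h1.trans ?_) (hker t) (norm_nonneg _) (by positivity)
              gcongr
          _ = _ := by
              rw [hA]
              ring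
    _ ≤ A * (8 * Real.log (4 / b) / b) := by
        rw [MeasureTheory.integral_const_mul]
        gcongr
    _ = _ := by
        have h4 : 4 / b = 8 * ‖z‖ / z.re := by
          rw [hb]
          field_simp
          norm_num
        rw [h4, hA, hb]
        field_simp

lemma exists_norm_tsum_vonMangoldt_sub_one_div_le (hRH : RiemannHypothesis) :
    ∃ C > 0, ∀ N : ℕ, 2 ≤ N → ∀ z : ℂ, z.re = 1 / N → ‖z‖ ≤ 4 →
      ‖∑' n : ℕ, (ArithmeticFunction.vonMangoldt n : ℂ) * cexp (-(z * n)) - 1 / z‖ ≤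
        C * √N * √(N * ‖z‖) * Real.log N := by
  obtain ⟨K₁, hK₁, h₁⟩ := exists_integral_abs_re_logDeriv_mul_gammaKernel_le hRH
  obtain ⟨K₂, hK₂, h₂⟩ := exists_integral_norm_logDeriv_mul_gammaKernel_le hRH
  refine ⟨2 * K₁ * 12 + K₂ * 12 + 4, by positivity, fun N hN z hzN hz4 ↦ ?_⟩
  have hN2 : (2 : ℝ) ≤ N := by exact_mod_cast hN
  have hN0 : (0 : ℝ) < N := by linarith
  have hz : 0 < z.re := by
    rw [hzN]
    positivity
  have hz0 : 0 < ‖z‖ := norm_pos_iff.mpr (ne_zero_of_re_pos hz)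
  have hre : z.re ≤ ‖z‖ := (le_abs_self _).trans (abs_re_le_norm z)
  have hY1 : 1 ≤ N * ‖z‖ := by
    rw [hzN, div_le_iff₀ hN0] at hre
    linarith
  have hlog2 := Real.log_two_gt_d9
  have hℓ : Real.log 2 ≤ Real.log N := Real.log_le_log (by norm_num) hN2
  have hℓ0 : 0 < Real.log N := by linarith
  set ℓ := Real.log N with hℓd
  set δ := 1 / (16 * ℓ) with hδ
  have hδ0 : 0 < δ := by positivity
  have hδ1 : δ ≤ 1 / 4 := by
    rw [hδ, div_le_iff₀ (by positivity)]
    linarith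
  have hpow : (2 / z.re) ^ δ ≤ 2 := by
    have h : 2 / z.re ≤ (N : ℝ) ^ (2 : ℝ) := by
      rw [hzN, Real.rpow_two, div_div_eq_mul_div, div_one]
      nlinarith
    calc (2 / z.re) ^ δ ≤ ((N : ℝ) ^ (2 : ℝ)) ^ δ := by gcongr
      _ = Real.exp (1 / 8) := by
          rw [← Real.rpow_mul hN0.le, Real.rpow_def_of_pos hN0, ← hℓd, hδ]
          congr 1
          field_simp
          norm_num
      _ ≤ Real.exp (Real.log 2) := Real.exp_le_exp.mpr (by linarith)
      _ = 2 := Real.exp_log (by norm_num)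
  have hlogb : Real.log (8 * ‖z‖ / z.re) ≤ 6 * ℓ := by
    have h : 8 * ‖z‖ / z.re ≤ (N : ℝ) ^ 6 := by
      rw [hzN, div_div_eq_mul_div, div_one]
      have h5 : (2 : ℝ) ^ 5 ≤ (N : ℝ) ^ 5 := by gcongr
      calc 8 * ‖z‖ * N ≤ 2 ^ 5 * N := by
            gcongr
            linarith
        _ ≤ (N : ℝ) ^ 5 * N := by gcongr
        _ = _ := by ring
    refine (Real.log_le_log (by positivity) h).trans (le_of_eq ?_)
    rw [Real.log_pow, hℓd]
    norm_num
  have hs : ‖z‖ ^ (-(1 / 2) : ℝ) * (N * ‖z‖) = √N * √(N * ‖z‖) := by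
    rw [Real.rpow_neg hz0.le, ← Real.sqrt_eq_rpow, Real.sqrt_mul hN0.le]
    have h3 : √‖z‖ ≠ 0 := (Real.sqrt_pos.mpr hz0).ne'
    field_simp
    rw [Real.sq_sqrt hN0.le, Real.sq_sqrt hz0.le, mul_comm]
  have hB : ‖z‖ ^ (-(1 / 2) : ℝ) * ((2 * ‖z‖ / z.re) * Real.log (8 * ‖z‖ / z.re)) ≤
      12 * (√N * √(N * ‖z‖) * ℓ) := by
    calc _ ≤ ‖z‖ ^ (-(1 / 2) : ℝ) * ((2 * ‖z‖ / z.re) * (6 * ℓ)) := by gcongr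
      _ = 12 * ((‖z‖ ^ (-(1 / 2) : ℝ) * (N * ‖z‖)) * ℓ) := by
          rw [hzN, div_div_eq_mul_div, div_one]
          ring
      _ = _ := by rw [hs]
  set B := √N * √(N * ‖z‖) * ℓ with hBd
  set P := ‖z‖ ^ (-(1 / 2) : ℝ) * ((2 * ‖z‖ / z.re) * Real.log (8 * ‖z‖ / z.re)) with hP
  have hP0 : 0 ≤ P := by
    have : 0 ≤ Real.log (8 * ‖z‖ / z.re) := Real.log_nonneg (by
      rw [le_div_iff₀ hz]
      linarith)
    positivity
  have hB2 : 2 ≤ 4 * B := by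
    have h3 : 1 ≤ √(N : ℝ) := Real.one_le_sqrt.mpr (by linarith)
    have h4 : 1 ≤ √(N * ‖z‖) := Real.one_le_sqrt.mpr hY1
    calc 2 ≤ 4 * (1 * 1 * ℓ) := by linarith
      _ ≤ _ := by rw [hBd]; gcongr
  have e₁ := h₁ z hz δ hδ0 (by linarith)
  have e₂ := h₂ z hz hz4 (2 * (1 / 2 + δ) - 1 / 4) (by linarith) (by linarith)
  have e₀ := norm_tsum_vonMangoldt_sub_le hRH hz (c := 1 / 2 + δ) (by linarith) (by linarith)
  have e₃ := norm_exp_neg_div_sub_one_div_le hz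
  have e₄ := norm_sub_le_norm_sub_add_norm_sub
    (∑' n : ℕ, (ArithmeticFunction.vonMangoldt n : ℂ) * cexp (-(z * n))) (cexp (-z) / z) (1 / z)
  have e₅ : K₁ * ‖z‖ ^ (-(1 / 2) : ℝ) * (2 / z.re) ^ δ *
      ((2 * ‖z‖ / z.re) * Real.log (8 * ‖z‖ / z.re)) ≤ 2 * K₁ * 12 * B := by
    calc _ = K₁ * (2 / z.re) ^ δ * P := by
          rw [hP]
          ring
      _ ≤ K₁ * 2 * (12 * B) := by gcongr
      _ = _ := by ring
  have e₆ : K₂ * ‖z‖ ^ (-(1 / 2) : ℝ) *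
      ((2 * ‖z‖ / z.re) * Real.log (8 * ‖z‖ / z.re)) ≤ K₂ * 12 * B := by
    calc _ = K₂ * P := by
          rw [hP]
          ring
      _ ≤ K₂ * (12 * B) := by gcongr
      _ = _ := by ring
  calc _ ≤ 2 * K₁ * 12 * B + K₂ * 12 * B + 4 * B := by linarith
    _ = _ := by
        rw [hBd]
        ring

end StildeAux

lemma Stilde_eq_tsum (N : ℕ) (α : ℝ) :
    Stilde N α = ∑' n : ℕ, (ArithmeticFunction.vonMangoldt n : ℂ) *
      Complex.exp (-(zOf N α * n)) := by
  refine tsum_congr fun n ↦ ?_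
  rw [vM, zOf, Complex.ofReal_exp, mul_assoc, ← Complex.exp_add]
  congr 2
  push_cast
  ring

lemma zOf_re (N : ℕ) (α : ℝ) : (zOf N α).re = 1 / N := by
  have h : zOf N α = (1 / N : ℝ) + (-(2 * Real.pi * α) : ℝ) * Complex.I := by
    rw [zOf]
    push_cast
    ring
  rw [h]
  simp

lemma norm_zOf_le (N : ℕ) (α : ℝ) : ‖zOf N α‖ ≤ 1 / N + 2 * Real.pi * |α| := by
  refine (norm_sub_le _ _).trans (le_of_eq ?_)
  simp [abs_of_pos Real.pi_pos]

theorem Stilde_pointwise_bound (hRH : RiemannHypothesis) :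
    ∃ C : ℝ, 0 < C ∧ ∀ N : ℕ, 2 ≤ N → ∀ α : ℝ, -(1/2) ≤ α → α ≤ 1/2 →
      ‖Stilde N α - 1 / zOf N α‖
        ≤ C * Real.sqrt N * (1 + Real.sqrt (N * |α|)) * Real.log N := by
  obtain ⟨C, hC, h⟩ := StildeAux.exists_norm_tsum_vonMangoldt_sub_one_div_le hRH
  refine ⟨C * 3, by positivity, fun N hN α hα hα' ↦ ?_⟩
  have hN2 : (2 : ℝ) ≤ N := by exact_mod_cast hN
  have hN0 : (0 : ℝ) < N := by linarith
  have hpi := Real.pi_lt_d2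
  have hpi0 := Real.pi_pos
  have hα2 : |α| ≤ 1 / 2 := abs_le.mpr ⟨hα, hα'⟩
  have hz := norm_zOf_le N α
  have hz4 : ‖zOf N α‖ ≤ 4 := by
    have h1 : 1 / (N : ℝ) ≤ 1 / 2 := by gcongr
    have h2 : 2 * Real.pi * |α| ≤ 2 * Real.pi * (1 / 2) := by gcongr
    linarith
  have hsqrt : √(N * ‖zOf N α‖) ≤ 3 * (1 + √(N * |α|)) := by
    refine Real.sqrt_le_iff.mpr ⟨by positivity, ?_⟩
    have hx : 0 ≤ N * |α| := by positivity
    have h3 : N * ‖zOf N α‖ ≤ 1 + 2 * Real.pi * (N * |α|) := by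
      calc N * ‖zOf N α‖ ≤ N * (1 / N + 2 * Real.pi * |α|) := by gcongr
        _ = _ := by field_simp
    nlinarith [Real.sq_sqrt hx, Real.sqrt_nonneg (N * |α|)]
  have hlog : 0 ≤ Real.log N := Real.log_nonneg (by linarith)
  rw [Stilde_eq_tsum]
  calc _ ≤ C * √N * √(N * ‖zOf N α‖) * Real.log N := h N hN _ (zOf_re N α) hz4
    _ ≤ C * √N * (3 * (1 + √(N * |α|))) * Real.log N := by gcongr
    _ = _ := by ring
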